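/- arXiv:math/0105002 — 4 statements merged into one kernel-verified Lean document; each statement's English description precedes it below -/
import Mathlib

section
/- For formal power series in q with parameters a and b, the following generalized Jacobi triple product identity holds: 1 + Σ_{n≥1} (-1)^n q^{n(n-1)/2} (a^n + b^n) = (q;q)_∞ (a;q)_∞ (b;q)_∞ · Σ_{n≥0} (ab/q;q)_{2n} q^n / ((q;q)_n (a;q)_n (b;q)_n (ab;q)_n). -/
open scoped BigOperators

/-- finite q-Pochhammer symbol `(x;q)_n = ∏_{j=0}^{n-1} (1 - x q^j)` -/
noncomputable def qPoch (x q : ℂ) (n : ℕ) : ℂ := ∏ j ∈ Finset.range n, (1 - x * q ^ j)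

/-- infinite q-Pochhammer symbol `(x;q)_∞ = ∏_{j≥0} (1 - x q^j)` -/
noncomputable def qPochInf (x q : ℂ) : ℂ := ∏' j : ℕ, (1 - x * q ^ j)

/-- Gaussian binomial coefficient in base q, zero outside `0 ≤ k ≤ m`. -/
noncomputable def qbinom (q : ℂ) (m k : ℤ) : ℂ :=
  if 0 ≤ k ∧ k ≤ m then
    qPoch q q m.toNat / (qPoch q q k.toNat * qPoch q q (m - k).toNat)
  else 0

section Helpers
open Filter Topology Finset

lemma qp_zero (x q : ℂ) : qPoch x q 0 = 1 := by simp [qPoch]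

lemma qp_succ (x q : ℂ) (n : ℕ) : qPoch x q (n + 1) = qPoch x q n * (1 - x * q ^ n) := by
  simp [qPoch, Finset.prod_range_succ]

lemma qp_add (x q : ℂ) (m n : ℕ) :
    qPoch x q (m + n) = qPoch x q m * qPoch (x * q ^ m) q n := by
  simp only [qPoch, Finset.prod_range_add]
  congr 1
  refine Finset.prod_congr rfl fun j _ => ?_
  ring

lemma qp_summable (x q : ℂ) (hq : ‖q‖ < 1) : Summable (fun j : ℕ => ‖-(x * q ^ j)‖) := by
  simp only [norm_neg, norm_mul, norm_pow]
  exact (summable_geometric_of_lt_one (norm_nonneg _) hq).mul_left _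

lemma qp_tendsto (x q : ℂ) (hq : ‖q‖ < 1) :
    Tendsto (qPoch x q) atTop (𝓝 (qPochInf x q)) := by
  have h := (multipliable_one_add_of_summable (qp_summable x q hq)).hasProd.tendsto_prod_nat
  simp only [← sub_eq_add_neg] at h
  exact h

lemma qpinf_ne (x q : ℂ) (hq : ‖q‖ < 1) (h : ∀ n, qPoch x q n ≠ 0) : qPochInf x q ≠ 0 := by
  have := tprod_one_add_ne_zero_of_summable (f := fun j : ℕ => -(x * q ^ j)) (fun j => by
    have h1 := h (j + 1)
    rw [qp_succ] at h1
    simpa only [← sub_eq_add_neg] using right_ne_zero_of_mul h1) (qp_summable x q hq)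
  simp only [← sub_eq_add_neg] at this
  exact this

lemma bdd_of_tendsto (f : ℕ → ℂ) (l : ℂ) (h : Tendsto f atTop (𝓝 l)) :
    ∃ C : ℝ, 0 ≤ C ∧ ∀ n, ‖f n‖ ≤ C := by
  obtain ⟨C, hC⟩ := h.norm.bddAbove_range
  exact ⟨C, (norm_nonneg _).trans (hC ⟨0, rfl⟩), fun n => hC ⟨n, rfl⟩⟩

lemma qp_bdd (x q : ℂ) (hq : ‖q‖ < 1) : ∃ C : ℝ, 0 ≤ C ∧ ∀ n, ‖qPoch x q n‖ ≤ C :=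
  bdd_of_tendsto _ _ (qp_tendsto x q hq)

lemma qp_inv_bdd (x q : ℂ) (hq : ‖q‖ < 1) (h : ∀ n, qPoch x q n ≠ 0) :
    ∃ C : ℝ, 0 ≤ C ∧ ∀ n, ‖(qPoch x q n)⁻¹‖ ≤ C :=
  bdd_of_tendsto _ _ ((qp_tendsto x q hq).inv₀ (qpinf_ne x q hq h))

lemma qpinf_split (x q : ℂ) (hq : ‖q‖ < 1) (m : ℕ) :
    qPochInf x q = qPoch x q m * qPochInf (x * q ^ m) q := by
  have h1 := (qp_tendsto (x * q ^ m) q hq).const_mul (qPoch x q m)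
  have h2 : Tendsto (fun n => qPoch x q (m + n)) atTop (𝓝 (qPochInf x q)) := by
    have := (tendsto_add_atTop_iff_nat m).2 (qp_tendsto x q hq)
    simpa only [add_comm] using this
  simp only [qp_add] at h2
  exact tendsto_nhds_unique h2 h1

lemma ch_succ (n : ℕ) : (n + 1).choose 2 = n.choose 2 + n := by
  rw [Nat.choose_succ_succ' n 1, Nat.choose_one_right]; ring

lemma ch_add (j d : ℕ) : (j + d).choose 2 = j.choose 2 + d.choose 2 + j * d := by
  induction d with
  | zero => simp
  | succ d ih => rw [← add_assoc, ch_succ, ch_succ, ih]; ring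

lemma ch_two (j : ℕ) : 2 * j.choose 2 + j = j * j := by
  induction j with
  | zero => simp
  | succ d ih => rw [ch_succ]; linarith

lemma sum_real (R t : ℝ) (hR : 0 ≤ R) (ht0 : 0 ≤ t) (ht : t < 1) :
    Summable (fun n : ℕ => R ^ n * t ^ (n.choose 2)) := by
  have hlim : Tendsto (fun n : ℕ => R * t ^ n) atTop (𝓝 0) := by
    simpa using (tendsto_pow_atTop_nhds_zero_of_lt_one ht0 ht).const_mul R
  refine summable_of_ratio_norm_eventually_le (r := 1 / 2) (by norm_num) ?_
  filter_upwards [hlim.eventually (gt_mem_nhds (show (0 : ℝ) < 1 / 2 by norm_num))] with n hn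
  have h0 : 0 ≤ R ^ n * t ^ (n.choose 2) := by positivity
  rw [Real.norm_of_nonneg h0, Real.norm_of_nonneg (by positivity), ch_succ]
  calc R ^ (n + 1) * t ^ (n.choose 2 + n) = (R * t ^ n) * (R ^ n * t ^ (n.choose 2)) := by ring
    _ ≤ _ := mul_le_mul_of_nonneg_right hn.le h0

/-- Euler summand. -/
noncomputable def eul (q x : ℂ) (k : ℕ) : ℂ := (-x) ^ k * q ^ (k.choose 2) * (qPoch q q k)⁻¹

lemma eul_summable (q x : ℂ) (hq : ‖q‖ < 1) (hqn : ∀ n : ℕ, qPoch q q n ≠ 0) :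
    Summable (fun k => ‖eul q x k‖) := by
  obtain ⟨C, hC0, hC⟩ := qp_inv_bdd q q hq hqn
  refine Summable.of_nonneg_of_le (fun _ => norm_nonneg _) (fun k => ?_)
    ((sum_real ‖x‖ ‖q‖ (norm_nonneg _) (norm_nonneg _) hq).mul_right C)
  rw [eul, norm_mul, norm_mul, norm_pow, norm_pow, norm_neg]
  exact mul_le_mul_of_nonneg_left (hC k) (by positivity)

lemma eul_scale (q x y : ℂ) (k : ℕ) : eul q (x * y) k = y ^ k * eul q x k := by
  rw [eul, eul, neg_mul_eq_neg_mul, mul_pow]; ring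

lemma eul_func (q x : ℂ) (hq : ‖q‖ < 1) (hqn : ∀ n : ℕ, qPoch q q n ≠ 0) :
    ∑' k, eul q x k = (1 - x) * ∑' k, eul q (x * q) k := by
  have s1 := (eul_summable q x hq hqn).of_norm
  have s2 := (eul_summable q (x * q) hq hqn).of_norm
  have h : ∑' k, eul q x k - ∑' k, eul q (x * q) k = -x * ∑' k, eul q (x * q) k := by
    rw [← s1.tsum_sub s2, (s1.sub s2).tsum_eq_zero_add, ← tsum_mul_left]
    have : eul q x 0 - eul q (x * q) 0 = 0 := by simp [eul]
    rw [this, zero_add]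
    refine tsum_congr fun k => ?_
    rw [eul_scale, eul_scale, eul, eul, ch_succ]
    have h1 := hqn (k + 1)
    have h2 := hqn k
    rw [qp_succ] at h1 ⊢
    have h3 := right_ne_zero_of_mul h1
    field_simp
    ring
  linear_combination h

lemma eul_hasSum (q x : ℂ) (hq : ‖q‖ < 1) (hqn : ∀ n : ℕ, qPoch q q n ≠ 0) :
    HasSum (eul q x) (qPochInf x q) := by
  have s1 := (eul_summable q x hq hqn)
  have hit : ∀ n : ℕ, ∑' k, eul q x k = qPoch x q n * ∑' k, eul q (x * q ^ n) k := by
    intro n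
    induction n with
    | zero => simp [qp_zero]
    | succ n ih =>
      rw [ih, eul_func q (x * q ^ n) hq hqn, qp_succ, pow_succ]
      ring_nf
  have hlim : Tendsto (fun n : ℕ => ∑' k, eul q (x * q ^ n) k) atTop
      (𝓝 (∑' k : ℕ, if k = 0 then (1 : ℂ) else 0)) := by
    refine tendsto_tsum_of_dominated_convergence s1 (fun k => ?_) (Eventually.of_forall fun n k => ?_)
    · simp only [eul_scale]
      rcases Nat.eq_zero_or_pos k with rfl | hk
      · simp [eul, qp_zero]
      · rw [if_neg hk.ne']
        have h0 : Tendsto (fun n : ℕ => (q ^ n) ^ k) atTop (𝓝 0) := by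
          have := (tendsto_pow_atTop_nhds_zero_of_norm_lt_one hq).pow k
          rwa [zero_pow hk.ne'] at this
        simpa using h0.mul_const (eul q x k)
    · rw [eul_scale, norm_mul]
      refine mul_le_of_le_one_left (norm_nonneg _) ?_
      rw [norm_pow, norm_pow]
      exact pow_le_one₀ (by positivity) (pow_le_one₀ (norm_nonneg _) hq.le)
  rw [tsum_ite_eq] at hlim
  have h2 := (qp_tendsto x q hq).mul hlim
  rw [mul_one] at h2
  have h3 : ∑' k, eul q x k = qPochInf x q := by
    refine tendsto_nhds_unique ?_ h2
    simp only [← hit]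
    exact tendsto_const_nhds
  rw [← h3]
  exact s1.of_norm.hasSum

/-- finite q-binomial theorem -/
lemma qbin (q x : ℂ) (hqn : ∀ n : ℕ, qPoch q q n ≠ 0) (m : ℕ) :
    ∑ p ∈ antidiagonal m, eul q x p.1 * (qPoch q q p.2)⁻¹ = qPoch x q m * (qPoch q q m)⁻¹ := by
  induction m with
  | zero => simp [eul, qp_zero]
  | succ m ih =>
    have hne : (1 - q * q ^ m) ≠ 0 := by
      have := hqn (m + 1); rw [qp_succ] at this; exact right_ne_zero_of_mul this
    have key : (1 - q * q ^ m) * ∑ p ∈ antidiagonal (m + 1), eul q x p.1 * (qPoch q q p.2)⁻¹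
        = (1 - x * q ^ m) * ∑ p ∈ antidiagonal m, eul q x p.1 * (qPoch q q p.2)⁻¹ := by
      have e1 : (1 - q * q ^ m) * ∑ p ∈ antidiagonal (m + 1), eul q x p.1 * (qPoch q q p.2)⁻¹
        = ∑ p ∈ antidiagonal (m + 1), (1 - q ^ p.2) * (eul q x p.1 * (qPoch q q p.2)⁻¹)
         + ∑ p ∈ antidiagonal (m + 1), q ^ p.2 * (1 - q ^ p.1) *
            (eul q x p.1 * (qPoch q q p.2)⁻¹) := by
        rw [← Finset.sum_add_distrib, Finset.mul_sum]
        refine Finset.sum_congr rfl fun p hp => ?_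
        rw [← pow_succ', ← mem_antidiagonal.1 hp]
        ring
      rw [e1, Finset.Nat.sum_antidiagonal_succ', Finset.Nat.sum_antidiagonal_succ]
      simp only [pow_zero, sub_self, zero_mul, mul_zero, zero_add, add_zero]
      rw [sub_mul, one_mul, sub_eq_add_neg, Finset.mul_sum, ← Finset.sum_neg_distrib]
      congr 1
      · refine Finset.sum_congr rfl fun p hp => ?_
        have h1 := hqn (p.2 + 1)
        have h2 := hqn p.2
        rw [qp_succ] at h1 ⊢
        have h3 := right_ne_zero_of_mul h1
        field_simp
        ring
      · refine Finset.sum_congr rfl fun p hp => ?_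
        rw [← mem_antidiagonal.1 hp, eul, eul, ch_succ]
        have h1 := hqn (p.1 + 1)
        have h2 := hqn p.1
        rw [qp_succ] at h1 ⊢
        have h3 := right_ne_zero_of_mul h1
        field_simp
        ring
    rw [ih] at key
    apply mul_left_cancel₀ hne
    have hm := hqn m
    rw [key, qp_succ, qp_succ, mul_inv]
    rw [show (1 - q * q ^ m) * (qPoch x q m * (1 - x * q ^ m) *
      ((qPoch q q m)⁻¹ * (1 - q * q ^ m)⁻¹)) = ((1 - q * q ^ m) * (1 - q * q ^ m)⁻¹) *
      ((1 - x * q ^ m) * (qPoch x q m * (qPoch q q m)⁻¹)) by ring, mul_inv_cancel₀ hne, one_mul]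

/-- vanishing sum -/
lemma van (q : ℂ) (hq0 : q ≠ 0) (hqn : ∀ n : ℕ, qPoch q q n ≠ 0) (M r : ℕ) (hr : r < M) :
    ∑ p ∈ antidiagonal M, (-1) ^ p.2 * q ^ ((p.2 + 1).choose 2) * (qPoch q q p.2)⁻¹ *
      (q ^ p.1 * q ^ (p.1 * r) * (qPoch q q p.1)⁻¹) = 0 := by
  have h := qbin q (q ^ r)⁻¹ hqn M
  have h0 : qPoch (q ^ r)⁻¹ q M = 0 := by
    refine Finset.prod_eq_zero (Finset.mem_range.2 hr) ?_
    rw [inv_mul_cancel₀ (pow_ne_zero _ hq0), sub_self]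
  rw [h0, zero_mul, ← Finset.Nat.sum_antidiagonal_swap] at h
  have h2 := congrArg (fun t => q ^ (M * (1 + r)) * t) h
  simp only [mul_zero, Finset.mul_sum] at h2
  rw [← h2]
  refine Finset.sum_congr rfl fun p hp => ?_
  rw [← mem_antidiagonal.1 hp, ch_succ]
  simp only [Prod.fst_swap, Prod.snd_swap, eul]
  rw [neg_pow (q ^ r)⁻¹, inv_pow]
  field_simp
  ring

lemma van2 (q x : ℂ) (hq0 : q ≠ 0) (hqn : ∀ n : ℕ, qPoch q q n ≠ 0)
    (hx : ∀ n, qPoch (x * q) q n ≠ 0) (M : ℕ) :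
    ∑ p ∈ antidiagonal (M + 1), qPoch x q (2 * p.1 + p.2) *
      (qPoch q q p.1 * qPoch (x * q) q p.1)⁻¹ * q ^ p.1 *
      ((-1) ^ p.2 * q ^ ((p.2 + 1).choose 2) * (qPoch q q p.2)⁻¹) = 0 := by
  have e : ∀ p ∈ antidiagonal (M + 1), qPoch x q (2 * p.1 + p.2) *
      (qPoch q q p.1 * qPoch (x * q) q p.1)⁻¹ * q ^ p.1 *
      ((-1) ^ p.2 * q ^ ((p.2 + 1).choose 2) * (qPoch q q p.2)⁻¹)
      = (1 - x) * qPoch q q M * ∑ s ∈ antidiagonal M, eul q (x * q) s.1 * (qPoch q q s.2)⁻¹ *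
        ((-1) ^ p.2 * q ^ ((p.2 + 1).choose 2) * (qPoch q q p.2)⁻¹ *
      (q ^ p.1 * q ^ (p.1 * s.1) * (qPoch q q p.1)⁻¹)) := by
    intro p hp
    have hp' := mem_antidiagonal.1 hp
    have h1 : 2 * p.1 + p.2 = 1 + (p.1 + M) := by omega
    have hb := qbin q (x * q * q ^ p.1) hqn M
    have h2 : qPoch x q (2 * p.1 + p.2) = (1 - x) * (qPoch (x * q) q p.1 *
        qPoch (x * q * q ^ p.1) q M) := by
      rw [h1, qp_add, qp_add]; simp [qPoch]
    have h3 : qPoch (x * q * q ^ p.1) q M = qPoch q q M *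
      ∑ s ∈ antidiagonal M, q ^ (p.1 * s.1) * (eul q (x * q) s.1 * (qPoch q q s.2)⁻¹) := by
      have : ∑ s ∈ antidiagonal M, q ^ (p.1 * s.1) * (eul q (x * q) s.1 * (qPoch q q s.2)⁻¹)
        = ∑ s ∈ antidiagonal M, eul q (x * q * q ^ p.1) s.1 * (qPoch q q s.2)⁻¹ := by
        refine Finset.sum_congr rfl fun s _ => ?_
        rw [eul_scale _ (x * q), ← pow_mul]; ring
      rw [this, hb]
      have := hqn M
      field_simp
    rw [h2, h3, mul_inv]
    have := hx p.1
    rw [Finset.mul_sum, Finset.mul_sum, Finset.mul_sum, Finset.mul_sum, Finset.sum_mul,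
      Finset.sum_mul, Finset.sum_mul]
    refine Finset.sum_congr rfl fun s _ => ?_
    field_simp
  rw [Finset.sum_congr rfl e, ← Finset.mul_sum, Finset.sum_comm]
  refine mul_eq_zero_of_right _ (Finset.sum_eq_zero fun s hs => ?_)
  have hs' := mem_antidiagonal.1 hs
  rw [← Finset.mul_sum, van q hq0 hqn (M + 1) s.1 (by omega), mul_zero]

lemma eul_alt (q x : ℂ) (k : ℕ) :
    eul q x k = (-1) ^ k * x ^ k * q ^ (k.choose 2) * (qPoch q q k)⁻¹ := by
  rw [eul, neg_pow]

lemma anti {f : ℕ × ℕ → ℂ} {s : ℂ} (h : HasSum f s) :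
    HasSum (fun m => ∑ p ∈ antidiagonal m, f p) s := by
  have h1 := (HasAntidiagonal.sigmaAntidiagonalEquivProd (A := ℕ).hasSum_iff).2 h
  have h2 := h1.sigma (fun m => hasSum_fintype _)
  convert h2 using 2 with m
  exact (Finset.sum_coe_sort (antidiagonal m) f).symm

lemma sum3 {f : ℕ × ℕ × ℕ → ℂ} {u v w : ℕ → ℝ} (hu : Summable u) (hv : Summable v)
    (hw : Summable w) (hu0 : 0 ≤ u) (hv0 : 0 ≤ v) (hw0 : 0 ≤ w)
    (h : ∀ n j k, ‖f (n, j, k)‖ ≤ u n * (v j * w k)) : Summable f := by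
  have h1 := hv.mul_of_nonneg hw hv0 hw0
  have h2 := hu.mul_of_nonneg h1 hu0 (fun p => mul_nonneg (hv0 _) (hw0 _))
  exact Summable.of_norm_bounded h2 (fun p => h p.1 p.2.1 p.2.2)

/-- the coefficient `(x)_{2n}/((q)_n (xq)_n)` -/
noncomputable def tt (q x : ℂ) (n : ℕ) : ℂ :=
  qPoch x q (2 * n) * (qPoch q q n * qPoch (x * q) q n)⁻¹

lemma tt_bdd (q x : ℂ) (hq : ‖q‖ < 1) (hqn : ∀ n : ℕ, qPoch q q n ≠ 0)
    (hx : ∀ n, qPoch (x * q) q n ≠ 0) : ∃ C : ℝ, 0 ≤ C ∧ ∀ n m,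
      ‖qPoch x q (2 * n + m) * (qPoch q q n * qPoch (x * q) q n)⁻¹‖ ≤ C := by
  obtain ⟨C1, h1, H1⟩ := qp_bdd x q hq
  obtain ⟨C2, h2, H2⟩ := qp_inv_bdd q q hq hqn
  obtain ⟨C3, h3, H3⟩ := qp_inv_bdd (x * q) q hq hx
  refine ⟨C1 * (C2 * C3), by positivity, fun n m => ?_⟩
  rw [mul_inv, norm_mul, norm_mul]
  have := H1 (2 * n + m)
  have := H2 n
  have := H3 n
  gcongr

lemma norm_pow_le_one {q : ℂ} (hq : ‖q‖ ≤ 1) (n : ℕ) : ‖q ^ n‖ ≤ 1 := by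
  rw [norm_pow]; exact pow_le_one₀ (norm_nonneg _) hq

/-- triple summand -/
noncomputable def HH (q x z : ℂ) (p : ℕ × ℕ × ℕ) : ℂ :=
  tt q x p.1 * (z * q) ^ p.1 *
    (((-1) ^ p.2.1 * q ^ ((p.2.1 + 1).choose 2 + 2 * p.1 * p.2.1) * eul q (x * z) p.2.1) *
      eul q (z * q * q ^ p.2.1) p.2.2)

noncomputable def hh (q x z : ℂ) (p : ℕ × ℕ) : ℂ :=
  qPoch x q (2 * p.1 + p.2) * (qPoch q q p.1 * qPoch (x * q) q p.1)⁻¹ * q ^ p.1 *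
      ((-1) ^ p.2 * q ^ ((p.2 + 1).choose 2) * (qPoch q q p.2)⁻¹) * z ^ (p.1 + p.2)

lemma HH_summable (q x z : ℂ) (hq : ‖q‖ < 1) (hz : ‖z‖ ≤ 1) (hqn : ∀ n : ℕ, qPoch q q n ≠ 0)
    (hx : ∀ n, qPoch (x * q) q n ≠ 0) : Summable (HH q x z) := by
  obtain ⟨C, hC0, hC⟩ := tt_bdd q x hq hqn hx
  refine sum3 (((summable_geometric_of_lt_one (norm_nonneg _) hq)).mul_left C)
    (eul_summable q (x * z) hq hqn) (eul_summable q (z * q) hq hqn)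
    (fun n => by positivity) (fun n => norm_nonneg _) (fun n => norm_nonneg _) fun n j k => ?_
  have e1 : ‖tt q x n‖ ≤ C := hC n 0
  have e2 : ‖(z * q) ^ n‖ ≤ ‖q‖ ^ n := by
    rw [norm_pow, norm_mul]
    exact pow_le_pow_left₀ (by positivity) (mul_le_of_le_one_left (norm_nonneg _) hz) n
  have e3 : ‖(-1 : ℂ) ^ j * q ^ ((j + 1).choose 2 + 2 * n * j) * eul q (x * z) j‖
      ≤ ‖eul q (x * z) j‖ := by
    rw [norm_mul, norm_mul]
    refine mul_le_of_le_one_left (norm_nonneg _) ?_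
    exact mul_le_one₀ (norm_pow_le_one (by simp) _) (norm_nonneg _) (norm_pow_le_one hq.le _)
  have e4 : ‖eul q (z * q * q ^ j) k‖ ≤ ‖eul q (z * q) k‖ := by
    rw [eul_scale, norm_mul, ← pow_mul]
    exact mul_le_of_le_one_left (norm_nonneg _) (norm_pow_le_one hq.le _)
  simp only [HH]
  rw [norm_mul, norm_mul (tt q x n), norm_mul _ (eul q (z * q * q ^ j) k)]
  gcongr

lemma hh_summable (q x z : ℂ) (hq : ‖q‖ < 1) (hz : ‖z‖ ≤ 1) (hqn : ∀ n : ℕ, qPoch q q n ≠ 0)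
    (hx : ∀ n, qPoch (x * q) q n ≠ 0) : Summable (hh q x z) := by
  obtain ⟨C, hC0, hC⟩ := tt_bdd q x hq hqn hx
  have h1 := ((summable_geometric_of_lt_one (norm_nonneg _) hq)).mul_left C
  have h2 := h1.mul_of_nonneg (eul_summable q q hq hqn) (fun n => by positivity)
    (fun n => norm_nonneg _)
  refine Summable.of_norm_bounded h2 (fun p => ?_)
  have e1 := hC p.1 p.2
  have e2 : (-1) ^ p.2 * q ^ ((p.2 + 1).choose 2) * (qPoch q q p.2)⁻¹ = eul q q p.2 := by
    rw [eul_alt, ch_succ]; ring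
  rw [hh, e2, norm_mul, norm_mul, norm_mul _ (q ^ p.1), norm_pow q]
  refine (mul_le_of_le_one_right (by positivity) (norm_pow_le_one hz _)).trans ?_
  gcongr

lemma HH_hh (q x z : ℂ) (hqn : ∀ n : ℕ, qPoch q q n ≠ 0) (n m : ℕ) :
    ∑ p ∈ antidiagonal m, HH q x z (n, p) = hh q x z (n, m) := by
  have h := qbin q (x * q ^ (2 * n)) hqn m
  have e : ∀ p ∈ antidiagonal m, HH q x z (n, p) =
      tt q x n * (z * q) ^ n * ((-1) ^ m * z ^ m * q ^ ((m + 1).choose 2)) *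
        (eul q (x * q ^ (2 * n)) p.1 * (qPoch q q p.2)⁻¹) := by
    intro p hp
    rw [← mem_antidiagonal.1 hp]
    simp only [HH, eul_alt, ch_succ, ch_add]
    ring
  rw [Finset.sum_congr rfl e, ← Finset.mul_sum, h, hh, tt, qp_add x q (2 * n) m]
  ring

lemma key (q x z : ℂ) (hq : ‖q‖ < 1) (hq0 : q ≠ 0) (hz : ‖z‖ ≤ 1)
    (hqn : ∀ n : ℕ, qPoch q q n ≠ 0) (hx : ∀ n, qPoch (x * q) q n ≠ 0) :
    HasSum (fun p : ℕ × ℕ => tt q x p.1 * (z * q) ^ p.1 *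
    (((-1) ^ p.2 * q ^ ((p.2 + 1).choose 2 + 2 * p.1 * p.2) * eul q (x * z) p.2) *
      qPochInf (z * q * q ^ p.2) q)) 1 := by
  have hs := HH_summable q x z hq hz hqn hx
  obtain ⟨S, hS⟩ := hs
  have hs := hS.summable
  have g1 : ∀ n, HasSum (fun p => HH q x z (n, p)) (∑' p, HH q x z (n, p)) :=
    fun n => (hs.prod_factor n).hasSum
  have g2 := hS.prod_fiberwise g1
  have g3 : ∀ n, HasSum (fun m => hh q x z (n, m)) (∑' p, HH q x z (n, p)) := by
    intro n
    have := anti (g1 n)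
    simpa only [HH_hh q x z hqn] using this
  obtain ⟨S', hS'⟩ := hh_summable q x z hq hz hqn hx
  have e1 : S = S' := g2.unique (hS'.prod_fiberwise g3)
  have e2 : S' = 1 := by
    refine (anti hS').unique ?_
    have : (fun m => ∑ p ∈ antidiagonal m, hh q x z p) = fun m => if m = 0 then 1 else 0 := by
      funext m
      rcases m with _ | M
      · simp [hh, qp_zero]
      · rw [if_neg (Nat.succ_ne_zero M)]
        have h0 := van2 q x hq0 hqn hx M
        have h1 := congrArg (fun t => t * z ^ (M + 1)) h0
        simp only [zero_mul, Finset.sum_mul] at h1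
        rw [← h1]
        refine Finset.sum_congr rfl fun p hp => ?_
        rw [hh, mem_antidiagonal.1 hp]
    rw [this]
    exact hasSum_ite_eq 0 1
  rw [e1, e2] at hS
  have h5 := ((Equiv.prodAssoc ℕ ℕ ℕ).hasSum_iff).2 hS
  refine h5.prod_fiberwise fun p => ?_
  simp only [HH, Function.comp, Equiv.prodAssoc_apply]
  exact ((eul_hasSum q _ hq hqn).mul_left _).mul_left _

lemma half (q x a b : ℂ) (hq : ‖q‖ < 1) (hq0 : q ≠ 0) (hab : x * q = a * b)
    (hqn : ∀ n : ℕ, qPoch q q n ≠ 0) (hx : ∀ n, qPoch (x * q) q n ≠ 0) (d : ℕ) :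
    HasSum (fun p : ℕ × ℕ => q ^ p.1 * tt q x p.1 *
      (eul q (a * q ^ p.1) (p.2 + d) * eul q (b * q ^ p.1) p.2))
      ((-a) ^ d * q ^ (d.choose 2) * (qPochInf q q)⁻¹) := by
  have h := (key q x (q ^ d) hq hq0 (norm_pow_le_one hq.le d) hqn hx).mul_right
    ((-a) ^ d * q ^ (d.choose 2) * (qPochInf q q)⁻¹)
  rw [one_mul] at h
  have hfun : (fun p : ℕ × ℕ => q ^ p.1 * tt q x p.1 *
      (eul q (a * q ^ p.1) (p.2 + d) * eul q (b * q ^ p.1) p.2)) =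
      fun p : ℕ × ℕ => tt q x p.1 * (q ^ d * q) ^ p.1 *
    (((-1) ^ p.2 * q ^ ((p.2 + 1).choose 2 + 2 * p.1 * p.2) * eul q (x * q ^ d) p.2) *
      qPochInf (q ^ d * q * q ^ p.2) q) * ((-a) ^ d * q ^ (d.choose 2) * (qPochInf q q)⁻¹) := by
    funext p
    obtain ⟨n, j⟩ := p
    have hI := qpinf_ne q q hq hqn
    have hs := qpinf_split q q hq (j + d)
    have e1 : q * q ^ (j + d) = q ^ d * q * q ^ j := by ring
    rw [e1] at hs
    have e2 : qPochInf (q ^ d * q * q ^ j) q * (qPochInf q q)⁻¹ = (qPoch q q (j + d))⁻¹ := by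
      rw [hs] at hI ⊢
      have h1 := left_ne_zero_of_mul hI
      have h2 := right_ne_zero_of_mul hI
      field_simp
    have e3 : a ^ j * b ^ j = x ^ j * q ^ j := by rw [← mul_pow, ← mul_pow, hab]
    have e4 : ∀ A B : ℂ, A * (B * qPochInf (q ^ d * q * q ^ j) q) *
        ((-a) ^ d * q ^ (d.choose 2) * (qPochInf q q)⁻¹) =
        A * B * ((-a) ^ d * q ^ (d.choose 2)) * (qPoch q q (j + d))⁻¹ := by
      intro A B
      rw [← e2]; ring
    simp only [e4]
    simp only [eul_alt, ch_succ, ch_add]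
    rw [neg_pow a d]
    have e5 : (a * q ^ n) ^ (j + d) * (b * q ^ n) ^ j =
        (x ^ j * q ^ j) * a ^ d * q ^ (n * (2 * j + d)) := by
      rw [← e3]; ring
    calc _ = q ^ n * tt q x n * ((-1) ^ (j + d) * (-1) ^ j) *
          ((a * q ^ n) ^ (j + d) * (b * q ^ n) ^ j) *
          q ^ (j.choose 2 + d.choose 2 + j * d) * q ^ (j.choose 2) *
          ((qPoch q q (j + d))⁻¹ * (qPoch q q j)⁻¹) := by ring
      _ = _ := by rw [e5]; ring
  rw [hfun]
  exact h

/-- main triple summand -/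
noncomputable def FF (q x a b : ℂ) (p : ℕ × ℕ × ℕ) : ℂ :=
  q ^ p.1 * tt q x p.1 * (eul q (a * q ^ p.1) p.2.1 * eul q (b * q ^ p.1) p.2.2)

lemma FF_summable (q x a b : ℂ) (hq : ‖q‖ < 1) (hqn : ∀ n : ℕ, qPoch q q n ≠ 0)
    (hx : ∀ n, qPoch (x * q) q n ≠ 0) : Summable (FF q x a b) := by
  obtain ⟨C, hC0, hC⟩ := tt_bdd q x hq hqn hx
  refine sum3 (((summable_geometric_of_lt_one (norm_nonneg _) hq)).mul_right C)
    (eul_summable q a hq hqn) (eul_summable q b hq hqn)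
    (fun n => by positivity) (fun n => norm_nonneg _) (fun n => norm_nonneg _) fun n j k => ?_
  have e1 : ‖tt q x n‖ ≤ C := hC n 0
  have e4 : ∀ c k, ‖eul q (c * q ^ n) k‖ ≤ ‖eul q c k‖ := by
    intro c k
    rw [eul_scale, norm_mul, ← pow_mul]
    exact mul_le_of_le_one_left (norm_nonneg _) (norm_pow_le_one hq.le _)
  have e5 := e4 a j
  have e6 := e4 b k
  simp only [FF]
  rw [norm_mul, norm_mul (q ^ n), norm_mul (eul q _ _), norm_pow]
  gcongr

lemma FF_fiber (q x a b : ℂ) (hq : ‖q‖ < 1) (hqn : ∀ n : ℕ, qPoch q q n ≠ 0)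
    {S : ℂ} (h : HasSum (FF q x a b) S) :
    HasSum (fun n => q ^ n * tt q x n * (qPochInf (a * q ^ n) q * qPochInf (b * q ^ n) q)) S := by
  refine h.prod_fiberwise fun n => ?_
  simp only [FF]
  refine HasSum.mul_left _ ?_
  refine (eul_hasSum q _ hq hqn).mul (eul_hasSum q _ hq hqn) ?_
  exact summable_mul_of_summable_norm (eul_summable q _ hq hqn) (eul_summable q _ hq hqn)

lemma FF_split (q x a b : ℂ) (hq : ‖q‖ < 1) (hq0 : q ≠ 0) (hab : x * q = a * b)
    (hqn : ∀ n : ℕ, qPoch q q n ≠ 0) (hx : ∀ n, qPoch (x * q) q n ≠ 0) :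
    ∃ S1 S2, HasSum (FF q x a b) (S1 + S2) ∧
      HasSum (fun d => (-a) ^ d * q ^ (d.choose 2) * (qPochInf q q)⁻¹) S1 ∧
      HasSum (fun d => (-b) ^ (d + 1) * q ^ ((d + 1).choose 2) * (qPochInf q q)⁻¹) S2 := by
  have hs := FF_summable q x a b hq hqn hx
  let f1 : ℕ × ℕ × ℕ → ℕ × ℕ × ℕ := fun p => (p.2.1, p.2.2 + p.1, p.2.2)
  let f2 : ℕ × ℕ × ℕ → ℕ × ℕ × ℕ := fun p => (p.2.1, p.2.2, p.2.2 + (p.1 + 1))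
  have i1 : Function.Injective f1 := by
    rintro ⟨d, n, j⟩ ⟨d', n', j'⟩ h
    simp only [f1, Prod.mk.injEq] at h ⊢
    omega
  have i2 : Function.Injective f2 := by
    rintro ⟨d, n, j⟩ ⟨d', n', j'⟩ h
    simp only [f2, Prod.mk.injEq] at h ⊢
    omega
  have hc : IsCompl (Set.range f1) (Set.range f2) := by
    rw [isCompl_iff, Set.disjoint_iff, codisjoint_iff]
    constructor
    · rintro p ⟨⟨⟨d, n, j⟩, h⟩, ⟨⟨d', n', j'⟩, rfl⟩⟩
      simp only [f1, f2, Prod.mk.injEq] at h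
      omega
    · refine Set.eq_univ_of_forall ?_
      rintro ⟨n, i, j⟩
      rcases le_or_gt j i with h | h
      · refine Or.inl ⟨(i - j, n, j), ?_⟩
        have e : j + (i - j) = i := by omega
        simp only [f1, e]
      · refine Or.inr ⟨(j - i - 1, n, i), ?_⟩
        have e : i + (j - i - 1 + 1) = j := by omega
        simp only [f2, e]
  obtain ⟨S1, h1⟩ := hs.comp_injective i1
  obtain ⟨S2, h2⟩ := hs.comp_injective i2
  refine ⟨S1, S2, HasSum.add_isCompl hc (i1.hasSum_range_iff.2 h1) (i2.hasSum_range_iff.2 h2),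
    h1.prod_fiberwise fun d => ?_, h2.prod_fiberwise fun d => ?_⟩
  · exact half q x a b hq hq0 hab hqn hx d
  · have := half q x b a hq hq0 (hab.trans (mul_comm _ _)) hqn hx (d + 1)
    simpa only [FF, f2, Function.comp, mul_comm (eul q (b * _) _)] using this


end Helpers

/-- Generalized Jacobi triple product identity (Theorem: pts). -/
theorem stmt_0 (q a b : ℂ) (hq : ‖q‖ < 1) (hq0 : q ≠ 0)
    (hqn : ∀ n : ℕ, qPoch q q n ≠ 0)
    (han : ∀ n : ℕ, qPoch a q n ≠ 0)
    (hbn : ∀ n : ℕ, qPoch b q n ≠ 0)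
    (habn : ∀ n : ℕ, qPoch (a * b) q n ≠ 0) :
    1 + ∑' n : ℕ, (-1 : ℂ) ^ (n + 1) * q ^ (n * (n + 1) / 2) * (a ^ (n + 1) + b ^ (n + 1))
      = qPochInf q q * qPochInf a q * qPochInf b q *
        ∑' n : ℕ, qPoch (a * b / q) q (2 * n) * q ^ n /
          (qPoch q q n * qPoch a q n * qPoch b q n * qPoch (a * b) q n) := by
  have hx : ∀ n, qPoch (a * b / q * q) q n ≠ 0 := by
    rw [div_mul_cancel₀ _ hq0]; exact habn
  have hI := qpinf_ne q q hq hqn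
  obtain ⟨S1, S2, hS, h1, h2⟩ := FF_split q (a * b / q) a b hq hq0 (div_mul_cancel₀ _ hq0) hqn hx
  have hF := FF_fiber q (a * b / q) a b hq hqn hS
  have hR : qPochInf a q * qPochInf b q * ∑' n : ℕ, qPoch (a * b / q) q (2 * n) * q ^ n /
          (qPoch q q n * qPoch a q n * qPoch b q n * qPoch (a * b) q n) = S1 + S2 := by
    rw [← hF.tsum_eq, ← tsum_mul_left]
    refine tsum_congr fun n => ?_
    rw [qpinf_split a q hq n, qpinf_split b q hq n, tt, div_mul_cancel₀ _ hq0]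
    have := hqn n
    have := han n
    have := hbn n
    have := habn n
    field_simp
  rw [mul_assoc (qPochInf q q), mul_assoc (qPochInf q q), hR]
  have h1' := ((hasSum_nat_add_iff' 1).2 h1).mul_left (qPochInf q q)
  have h3 := h1'.add (h2.mul_left (qPochInf q q))
  have h4 : HasSum (fun n : ℕ => (-1 : ℂ) ^ (n + 1) * q ^ (n * (n + 1) / 2) *
      (a ^ (n + 1) + b ^ (n + 1))) (qPochInf q q * (S1 + S2) - 1) := by
    have eA : (fun n : ℕ => (-1 : ℂ) ^ (n + 1) * q ^ (n * (n + 1) / 2) *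
        (a ^ (n + 1) + b ^ (n + 1))) = fun n : ℕ =>
        qPochInf q q * ((-a) ^ (n + 1) * q ^ (n + 1).choose 2 * (qPochInf q q)⁻¹) +
        qPochInf q q * ((-b) ^ (n + 1) * q ^ (n + 1).choose 2 * (qPochInf q q)⁻¹) := by
      funext n
      have e : n * (n + 1) / 2 = (n + 1).choose 2 := by
        rw [Nat.choose_two_right, Nat.add_sub_cancel, mul_comm]
      rw [e, neg_pow a, neg_pow b]
      field_simp
    have eB : qPochInf q q * (S1 + S2) - 1 = qPochInf q q * (S1 - ∑ i ∈ Finset.range 1,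
        (-a) ^ i * q ^ i.choose 2 * (qPochInf q q)⁻¹) + qPochInf q q * S2 := by
      rw [Finset.sum_range_one, Nat.choose_zero_succ, pow_zero, pow_zero, one_mul, one_mul,
        mul_sub, mul_inv_cancel₀ hI]
      ring
    rw [eA, eB]
    exact h3
  rw [h4.tsum_eq]
  ring
end

section
/- Ramanujan's partial theta identity: Σ_{n≥0} (q;q^2)_n q^n / ((a;q)_{n+1} (q/a;q)_n) = Σ_{n≥0} a^n q^{n(n+1)/2} + Σ_{n≥0} (-1)^n a^{2n+1} q^{n(n+1)} / ((-q;q)_∞ (a;q)_∞ (q/a;q)_∞). -/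
open scoped BigOperators

open Filter Topology

namespace PT

lemma poch_succ (x q : ℂ) (n : ℕ) : qPoch x q (n+1) = qPoch x q n * (1 - x * q^n) := by
  simp [qPoch, Finset.prod_range_succ]

lemma poch_succ' (x q : ℂ) (n : ℕ) : qPoch x q (n+1) = (1 - x) * qPoch (x*q) q n := by
  unfold qPoch
  rw [Finset.prod_range_succ']
  simp only [pow_zero, mul_one]
  rw [mul_comm]
  congr 1
  refine Finset.prod_congr rfl fun j _ => ?_
  ring

lemma poch_add (x q : ℂ) (M n : ℕ) : qPoch x q (M+n) = qPoch x q M * qPoch (x*q^M) q n := by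
  unfold qPoch
  rw [Finset.prod_range_add]
  congr 1
  refine Finset.prod_congr rfl fun j _ => ?_
  ring

lemma summ_aux (x q : ℂ) (hq : ‖q‖ < 1) : Summable (fun j : ℕ => ‖-(x * q^j)‖) := by
  simp only [norm_neg, norm_mul, norm_pow]
  exact (summable_geometric_of_lt_one (norm_nonneg _) hq).mul_left _

lemma mult (x q : ℂ) (hq : ‖q‖ < 1) : Multipliable (fun j : ℕ => 1 - x * q^j) := by
  have := multipliable_one_add_of_summable (summ_aux x q hq)
  simpa [sub_eq_add_neg] using this

lemma tend (x q : ℂ) (hq : ‖q‖ < 1) :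
    Tendsto (qPoch x q) atTop (𝓝 (qPochInf x q)) :=
  (mult x q hq).hasProd.tendsto_prod_nat

lemma inf_ne (x q : ℂ) (hq : ‖q‖ < 1) (h : ∀ j : ℕ, 1 - x * q^j ≠ 0) : qPochInf x q ≠ 0 := by
  have := tprod_one_add_ne_zero_of_summable (f := fun j : ℕ => -(x * q^j))
    (fun j => by simpa [sub_eq_add_neg] using h j) (summ_aux x q hq)
  simpa [qPochInf, sub_eq_add_neg] using this

lemma inf_succ (x q : ℂ) (hq : ‖q‖ < 1) : qPochInf x q = (1 - x) * qPochInf (x*q) q := by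
  have h1 := (tend x q hq).comp (tendsto_add_atTop_nat 1)
  have h2 := (tend (x*q) q hq).const_mul (1 - x)
  refine tendsto_nhds_unique h1 (h2.congr fun n => ?_)
  simp [poch_succ']

lemma fin_ne (x q : ℂ) (h : ∀ j : ℕ, 1 - x * q^j ≠ 0) (n : ℕ) : qPoch x q n ≠ 0 :=
  Finset.prod_ne_zero_iff.2 fun j _ => h j

lemma bdd (x q : ℂ) (hq : ‖q‖ < 1) : ∃ C : ℝ, 0 < C ∧ ∀ n, ‖qPoch x q n‖ ≤ C := by
  obtain ⟨C, hC⟩ := (tend x q hq).norm.bddAbove_range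
  refine ⟨max C 1, by positivity, fun n => le_max_of_le_left (hC ⟨n, rfl⟩)⟩

lemma bdd_inv (x q : ℂ) (hq : ‖q‖ < 1) (h : ∀ j : ℕ, 1 - x * q^j ≠ 0) :
    ∃ C : ℝ, 1 ≤ C ∧ ∀ n, ‖(qPoch x q n)⁻¹‖ ≤ C := by
  obtain ⟨C, hC⟩ := ((tend x q hq).inv₀ (inf_ne x q hq h)).norm.bddAbove_range
  refine ⟨max C 1, le_max_right _ _, fun n => le_max_of_le_left (hC ⟨n, rfl⟩)⟩

lemma pow_ne (q : ℂ) (hq : ‖q‖ < 1) (j : ℕ) : 1 - q * q^j ≠ 0 := by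
  intro h
  have h1 : ‖q^(j+1)‖ = 1 := by
    rw [pow_succ', ← sub_eq_zero.1 h, norm_one]
  rw [norm_pow] at h1
  exact absurd h1 (pow_lt_one₀ (norm_nonneg _) hq (by omega)).ne

/-- Euler. -/
lemma euler_fin (q : ℂ) (n : ℕ) :
    qPoch q (q^2) n * qPoch (-q) q n * qPoch q q n = qPoch q q (2*n) := by
  induction n with
  | zero => simp [qPoch]
  | succ n ih =>
    rw [show 2*(n+1) = 2*n+1+1 by ring]
    simp only [poch_succ, ← ih]
    ring

lemma sq_lt (q : ℂ) (hq : ‖q‖ < 1) : ‖q^2‖ < 1 := by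
  rw [norm_pow]; exact pow_lt_one₀ (norm_nonneg _) hq (by omega)

lemma euler (q : ℂ) (hq : ‖q‖ < 1) : qPochInf q (q^2) * qPochInf (-q) q = 1 := by
  have h1 := ((tend q (q^2) (sq_lt q hq)).mul (tend (-q) q hq)).mul (tend q q hq)
  have h2 := (tend q q hq).comp (tendsto_id.const_mul_atTop' (r := 2) (by norm_num))
  have h3 := tendsto_nhds_unique h1 (h2.congr fun n => (euler_fin q n).symm)
  have := inf_ne q q hq (pow_ne q hq)
  exact mul_right_cancel₀ this (by rw [h3, one_mul])

def Adm (q a : ℂ) : Prop := a ≠ 0 ∧ ∀ n : ℤ, a ≠ q ^ n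

lemma Adm.mul {q a : ℂ} (hq0 : q ≠ 0) (h : Adm q a) : Adm q (a*q) := by
  refine ⟨mul_ne_zero h.1 hq0, fun n hn => h.2 (n-1) ?_⟩
  rw [zpow_sub_one₀ hq0, ← hn]; field_simp

lemma Adm.mul_pow {q a : ℂ} (hq0 : q ≠ 0) (h : Adm q a) (M : ℕ) : Adm q (a*q^M) := by
  induction M with
  | zero => simpa using h
  | succ n ih => rw [pow_succ, ← mul_assoc]; exact ih.mul hq0

lemma Adm.ne1 {q a : ℂ} (hq0 : q ≠ 0) (h : Adm q a) (j : ℕ) : 1 - a * q^j ≠ 0 := by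
  intro h1
  apply h.2 (-j)
  rw [zpow_neg, zpow_natCast]
  exact eq_inv_of_mul_eq_one_left (sub_eq_zero.1 h1).symm

lemma Adm.ne2 {q a : ℂ} (h : Adm q a) (j : ℕ) : 1 - q / a * q^j ≠ 0 := by
  intro h1
  apply h.2 ((j+1 : ℕ))
  have := h.1
  rw [zpow_natCast]
  field_simp at h1
  linear_combination h1

lemma Adm.ne3 {q a : ℂ} (hq0 : q ≠ 0) (h : Adm q a) (j : ℕ) : a - q^j ≠ 0 := by
  intro h1
  apply h.2 (j : ℕ)
  rw [zpow_natCast]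
  linear_combination h1

noncomputable def tF (q a : ℂ) (n : ℕ) : ℂ :=
  qPoch q (q ^ 2) n * q ^ n / (qPoch a q (n + 1) * qPoch (q / a) q n)
noncomputable def tT (q a : ℂ) (n : ℕ) : ℂ := a ^ n * q ^ (n * (n + 1) / 2)
noncomputable def tS (q a : ℂ) (n : ℕ) : ℂ := (-1 : ℂ) ^ n * a ^ (2 * n + 1) * q ^ (n * (n + 1))
noncomputable def J (q a : ℂ) : ℂ := qPochInf (-q) q * qPochInf a q * qPochInf (q / a) q
noncomputable def U (q a : ℂ) (n : ℕ) : ℂ :=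
  (a - q^n) * qPoch q (q ^ 2) n / (qPoch a q (n + 1) * qPoch (q / a) q n)

lemma tele {q a : ℂ} (hq0 : q ≠ 0) (h : Adm q a) (n : ℕ) :
    tF q a n - a * q * tF q (a*q) n = U q a (n+1) - U q a n := by
  have ha := h.1
  have e1 : qPoch (a*q) q (n+1) = qPoch a q n * (1 - a*q^n) * (1 - a*q^(n+1)) / (1 - a) := by
    have := poch_succ' a q (n+1)
    rw [poch_succ, poch_succ] at this
    have h1 := h.ne1 hq0 0
    rw [pow_zero, mul_one] at h1
    rw [this]; field_simp
  have h3 : 1 - q/(a*q) ≠ 0 := by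
    have := h.ne3 hq0 0
    rw [pow_zero] at this
    rw [show 1 - q/(a*q) = (a-1)/a by field_simp]
    exact div_ne_zero this ha
  have e2 : qPoch (q/(a*q)) q n = (1 - 1/a) * qPoch (q/a) q n / (1 - q^n/a) := by
    have := poch_succ' (q/(a*q)) q n
    rw [poch_succ, show q/(a*q)*q = q/a by field_simp, show q/(a*q) = 1/a by field_simp] at this
    have h1 := h.ne3 hq0 n
    have h1 : 1 - q^n/a ≠ 0 := by
      rw [show 1 - q^n/a = (a-q^n)/a by field_simp]
      exact div_ne_zero h1 ha
    rw [eq_div_iff h1, ← this, show q/(a*q) = 1/a by field_simp]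
    ring
  unfold tF U
  rw [e1, e2]
  simp only [poch_succ]
  have f1 := fin_ne a q (h.ne1 hq0) n
  have f2 := fin_ne (q/a) q h.ne2 n
  have g1 := h.ne1 hq0 n
  have g2 := h.ne1 hq0 (n+1)
  have g3 := h.ne3 hq0 n
  have g4 := h.ne3 hq0 (n+1)
  have g5 := h.ne3 hq0 0
  have g6 := h.ne1 hq0 0
  have e3 : 1 - q / a * q^n = (a - q^(n+1))/a := by field_simp; ring
  have e4 : 1 - q^n/a = (a - q^n)/a := by field_simp
  have e5 : 1 - 1/a = (a - 1)/a := by field_simp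
  have e6 : 1 - a = -(a-1) := by ring
  rw [e3, e4, e5, e6]
  rw [pow_zero] at g5
  generalize qPoch a q n = A at *
  generalize qPoch (q/a) q n = B at *
  generalize qPoch q (q^2) n = Q at *
  rw [pow_succ] at *
  rw [← pow_mul, mul_comm 2 n, pow_mul]
  generalize q^n = X at *
  clear e1 e2 e3 e4 e5 e6 g6 h3
  obtain ⟨d1, hd1⟩ : ∃ d, d = 1 - a * X := ⟨_, rfl⟩
  obtain ⟨d2, hd2⟩ : ∃ d, d = 1 - a * (X * q) := ⟨_, rfl⟩
  obtain ⟨d3, hd3⟩ : ∃ d, d = a - X * q := ⟨_, rfl⟩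
  obtain ⟨d4, hd4⟩ : ∃ d, d = a - X := ⟨_, rfl⟩
  obtain ⟨d5, hd5⟩ : ∃ d, d = a - 1 := ⟨_, rfl⟩
  rw [← hd1] at g1 ⊢
  rw [← hd2] at g2 ⊢
  rw [← hd3] at g4 ⊢
  rw [← hd4] at g3 ⊢
  rw [← hd5] at g5 ⊢
  field_simp
  rw [hd2, hd4]
  ring

lemma tF_bound {q a : ℂ} (hq : ‖q‖ < 1) (hq0 : q ≠ 0) (h : Adm q a) :
    ∃ C : ℝ, ∀ n, ‖tF q a n‖ ≤ C * ‖q‖^n := by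
  obtain ⟨C1, p1, h1⟩ := bdd q (q^2) (sq_lt q hq)
  obtain ⟨C2, p2, h2⟩ := bdd_inv a q hq (h.ne1 hq0)
  obtain ⟨C3, p3, h3⟩ := bdd_inv (q/a) q hq h.ne2
  refine ⟨C1 * C2 * C3, fun n => ?_⟩
  have : tF q a n = qPoch q (q^2) n * (qPoch a q (n+1))⁻¹ * (qPoch (q/a) q n)⁻¹ * q^n := by
    unfold tF; rw [div_eq_mul_inv, mul_inv]; ring
  rw [this, norm_mul, norm_mul, norm_mul, norm_pow]
  gcongr
  · exact h1 n
  · exact h2 _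
  · exact h3 _

lemma tF_summable {q a : ℂ} (hq : ‖q‖ < 1) (hq0 : q ≠ 0) (h : Adm q a) : Summable (tF q a) := by
  obtain ⟨C, hC⟩ := tF_bound hq hq0 h
  exact Summable.of_norm_bounded ((summable_geometric_of_lt_one (norm_nonneg _) hq).mul_left C) hC

lemma F_eq {q a : ℂ} (hq : ‖q‖ < 1) (hq0 : q ≠ 0) (h : Adm q a) :
    ∑' n, tF q a n = a * q * ∑' n, tF q (a*q) n + 1 + a / J q a := by
  have s1 := tF_summable hq hq0 h
  have s2 := (tF_summable hq hq0 (h.mul hq0)).mul_left (a*q)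
  have hs := (s1.sub s2).hasSum.tendsto_sum_nat
  rw [s1.tsum_sub s2, tsum_mul_left] at hs
  have hU : Tendsto (U q a) atTop (𝓝 ((a - 0) * qPochInf q (q^2) / (qPochInf a q * qPochInf (q/a) q))) := by
    refine Tendsto.div ?_ ?_ (mul_ne_zero (inf_ne _ _ hq (h.ne1 hq0)) (inf_ne _ _ hq h.ne2))
    · exact (tendsto_const_nhds.sub (tendsto_pow_atTop_nhds_zero_of_norm_lt_one hq)).mul
        (tend _ _ (sq_lt q hq))
    · exact ((tend a q hq).comp (tendsto_add_atTop_nat 1)).mul (tend _ _ hq)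
  have hs2 := hU.sub_const (U q a 0)
  have key := tendsto_nhds_unique hs (hs2.congr fun n => ?_)
  · have u0 : U q a 0 = -1 := by
      have g6 := h.ne1 hq0 0
      simp only [pow_zero, mul_one] at g6
      simp [U, qPoch]
      field_simp
      ring
    have e := euler q hq
    have e' : qPochInf (-q) q ≠ 0 := right_ne_zero_of_mul_eq_one e
    have : a / J q a = (a - 0) * qPochInf q (q^2) / (qPochInf a q * qPochInf (q/a) q) := by
      rw [eq_div_of_mul_eq e' e]
      have := inf_ne _ _ hq (h.ne1 hq0)
      have := inf_ne _ _ hq h.ne2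
      unfold J
      field_simp
      ring
    rw [this]
    rw [u0] at key
    linear_combination key
  · simp only [tele hq0 h]
    rw [Finset.sum_range_sub]

lemma tT_succ (q a : ℂ) (n : ℕ) : tT q a (n+1) = a * q * tT q (a*q) n := by
  unfold tT
  have : (n+1)*(n+1+1)/2 = n*(n+1)/2 + (n+1) := by
    rw [show (n+1)*(n+1+1) = n*(n+1) + (n+1)*2 by ring, Nat.add_mul_div_right _ _ (by norm_num)]
  rw [this]; ring

lemma tT_succ2 (q a : ℂ) (n : ℕ) : tT q a (n+1) = a * q^(n+1) * tT q a n := by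
  unfold tT
  have : (n+1)*(n+1+1)/2 = n*(n+1)/2 + (n+1) := by
    rw [show (n+1)*(n+1+1) = n*(n+1) + (n+1)*2 by ring, Nat.add_mul_div_right _ _ (by norm_num)]
  rw [this]; ring

lemma tS_succ (q a : ℂ) (n : ℕ) : tS q a (n+1) = -(a^2 * q) * tS q (a*q) n := by
  unfold tS; ring

lemma tS_succ2 (q a : ℂ) (n : ℕ) : tS q a (n+1) = -(a^2 * (q^(n+1))^2) * tS q a n := by
  unfold tS; ring

lemma q_tend {q : ℂ} (hq : ‖q‖ < 1) : Tendsto (fun n : ℕ => q^(n+1)) atTop (𝓝 0) :=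
  (tendsto_pow_atTop_nhds_zero_of_norm_lt_one hq).comp (tendsto_add_atTop_nat 1)

lemma tT_summable {q a : ℂ} (hq : ‖q‖ < 1) (hq0 : q ≠ 0) (ha : a ≠ 0) : Summable (tT q a) := by
  have hne : ∀ n, tT q a n ≠ 0 := fun n => by unfold tT; positivity
  refine summable_of_ratio_test_tendsto_lt_one (l := 0) one_pos (.of_forall hne) ?_
  have := ((q_tend hq).const_mul a).norm
  simp only [mul_zero, norm_zero] at this
  refine this.congr fun n => ?_
  rw [tT_succ2, norm_mul (a * _), mul_div_cancel_right₀ _ (norm_ne_zero_iff.2 (hne n))]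

lemma tS_summable {q a : ℂ} (hq : ‖q‖ < 1) (hq0 : q ≠ 0) (ha : a ≠ 0) : Summable (tS q a) := by
  have hne : ∀ n, tS q a n ≠ 0 := fun n => by
    unfold tS
    exact mul_ne_zero (mul_ne_zero (pow_ne_zero _ (by norm_num)) (pow_ne_zero _ ha)) (pow_ne_zero _ hq0)
  refine summable_of_ratio_test_tendsto_lt_one (l := 0) one_pos (.of_forall hne) ?_
  have := ((((q_tend hq).pow 2).const_mul (a^2)).neg).norm
  simp only [ne_eq, OfNat.ofNat_ne_zero, not_false_eq_true, zero_pow, mul_zero, neg_zero, norm_zero] at this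
  refine this.congr fun n => ?_
  rw [tS_succ2, norm_mul (-_), mul_div_cancel_right₀ _ (norm_ne_zero_iff.2 (hne n))]

lemma T_eq {q a : ℂ} (hq : ‖q‖ < 1) (hq0 : q ≠ 0) (ha : a ≠ 0) :
    ∑' n, tT q a n = 1 + a * q * ∑' n, tT q (a*q) n := by
  rw [(tT_summable hq hq0 ha).tsum_eq_zero_add]
  simp only [tT_succ, tsum_mul_left]
  simp [tT]

lemma S_eq {q a : ℂ} (hq : ‖q‖ < 1) (hq0 : q ≠ 0) (ha : a ≠ 0) :
    ∑' n, tS q a n = a - a^2 * q * ∑' n, tS q (a*q) n := by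
  rw [(tS_summable hq hq0 ha).tsum_eq_zero_add]
  simp only [tS_succ, tsum_mul_left]
  simp [tS]
  ring

lemma J_eq {q a : ℂ} (hq : ‖q‖ < 1) (hq0 : q ≠ 0) (h : Adm q a) : J q a = -a * J q (a*q) := by
  have ha := h.1
  unfold J
  have g := h.ne3 hq0 0
  rw [inf_succ a q hq, inf_succ (q/(a*q)) q hq, show q/(a*q)*q = q/a by field_simp,
    show q/(a*q) = 1/a by field_simp]
  field_simp
  ring

lemma J_ne {q a : ℂ} (hq : ‖q‖ < 1) (hq0 : q ≠ 0) (h : Adm q a) : J q a ≠ 0 :=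
  mul_ne_zero (mul_ne_zero (right_ne_zero_of_mul_eq_one (euler q hq)) (inf_ne _ _ hq (h.ne1 hq0)))
    (inf_ne _ _ hq h.ne2)

noncomputable def D (q a : ℂ) : ℂ :=
  ∑' n, tF q a n - (∑' n, tT q a n + (∑' n, tS q a n) / J q a)

lemma D_eq {q a : ℂ} (hq : ‖q‖ < 1) (hq0 : q ≠ 0) (h : Adm q a) : D q a = a * q * D q (a*q) := by
  unfold D
  have ha := h.1
  have := J_ne hq hq0 (h.mul hq0)
  rw [F_eq hq hq0 h, T_eq hq hq0 ha, S_eq hq hq0 ha, J_eq hq hq0 h]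
  field_simp
  ring

lemma P_bound {q b : ℂ} (hq : ‖q‖ < 1) (hq0 : q ≠ 0) (h : Adm q b) (hb : ‖b‖ ≤ 1/2) :
    ∃ C : ℝ, 0 ≤ C ∧ ∀ M n : ℕ, ‖(qPoch (q/(b*q^M)) q n)⁻¹‖ ≤ C := by
  obtain ⟨C, p, hC⟩ := bdd_inv (q/b) q hq h.ne2
  refine ⟨C, by linarith, fun M => ?_⟩
  induction M with
  | zero => simpa using hC
  | succ M ih =>
    intro n
    rcases n with _ | n
    · simpa [qPoch] using p
    · have hb0 := h.1
      rw [poch_succ', show q/(b*q^(M+1))*q = q/(b*q^M) by field_simp; ring, mul_inv, norm_mul]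
      have : ‖(1 - q / (b*q^(M+1)))⁻¹‖ ≤ 1 := by
        rw [norm_inv]
        apply inv_le_one_of_one_le₀
        have e : q / (b*q^(M+1)) = (b*q^M)⁻¹ := by field_simp; ring
        have h1 : ‖b * q^M‖ ≤ 1/2 := by
          rw [norm_mul, norm_pow]
          have := pow_le_one₀ (n := M) (norm_nonneg q) hq.le
          nlinarith [norm_nonneg b]
        have h2 : 2 ≤ ‖(b*q^M)⁻¹‖ := by
          rw [norm_inv]
          have : 0 < ‖b*q^M‖ := norm_pos_iff.2 (h.mul_pow hq0 M).1
          rw [le_inv_comm₀ (by norm_num) this]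
          linarith
        rw [e]
        have := norm_sub_norm_le ((b*q^M)⁻¹) 1
        rw [norm_sub_rev, norm_one] at this
        linarith
      calc _ ≤ 1 * C := by
            gcongr
            exact ih n
        _ = C := one_mul C

lemma F_bound {q b : ℂ} (hq : ‖q‖ < 1) (hq0 : q ≠ 0) (h : Adm q b) (hb : ‖b‖ ≤ 1/2) :
    ∃ C : ℝ, ∀ M : ℕ, ‖∑' n, tF q (b*q^M) n‖ ≤ C := by
  obtain ⟨C1, p1, h1⟩ := bdd q (q^2) (sq_lt q hq)
  obtain ⟨C2, p2, h2⟩ := bdd_inv b q hq (h.ne1 hq0)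
  obtain ⟨C4, p4, h4⟩ := bdd b q hq
  obtain ⟨C3, p3, h3⟩ := P_bound hq hq0 h hb
  refine ⟨_, fun M => tsum_of_norm_bounded
    ((hasSum_geometric_of_lt_one (norm_nonneg _) hq).mul_left (C1 * (C4 * C2) * C3)) fun n => ?_⟩
  have e : (qPoch (b*q^M) q (n+1))⁻¹ = qPoch b q M * (qPoch b q (M+(n+1)))⁻¹ := by
    rw [poch_add b q M]
    have := fin_ne b q (h.ne1 hq0) M
    rw [mul_inv, mul_inv_cancel_left₀ this]
  have : tF q (b*q^M) n = qPoch q (q^2) n * (qPoch b q M * (qPoch b q (M+(n+1)))⁻¹)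
      * (qPoch (q/(b*q^M)) q n)⁻¹ * q^n := by
    unfold tF; rw [div_eq_mul_inv, mul_inv, e]; ring
  rw [this, norm_mul, norm_mul, norm_mul, norm_mul, norm_pow]
  gcongr
  · exact h1 n
  · exact h4 _
  · exact h2 _
  · exact h3 _ _

lemma small_pow {q b : ℂ} (hq : ‖q‖ < 1) (hb : ‖b‖ ≤ 1/2) (M : ℕ) : ‖b * q^M‖ ≤ 1/2 := by
  rw [norm_mul, norm_pow]
  have := pow_le_one₀ (n := M) (norm_nonneg q) hq.le
  nlinarith [norm_nonneg b]

lemma T_bound {q b : ℂ} (hq : ‖q‖ < 1) (hb : ‖b‖ ≤ 1/2) : ‖∑' n, tT q b n‖ ≤ 2 := by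
  refine tsum_of_norm_bounded hasSum_geometric_two fun n => ?_
  unfold tT
  rw [norm_mul, norm_pow, norm_pow]
  calc _ ≤ (1/2)^n * (1:ℝ) := by
        gcongr
        exact pow_le_one₀ (norm_nonneg q) hq.le
    _ = _ := mul_one _

lemma S_bound {q b : ℂ} (hq : ‖q‖ < 1) (hb : ‖b‖ ≤ 1/2) : ‖∑' n, tS q b n‖ ≤ 2 := by
  refine tsum_of_norm_bounded hasSum_geometric_two fun n => ?_
  unfold tS
  rw [norm_mul, norm_mul, norm_pow, norm_pow, norm_pow, norm_neg, norm_one, one_pow, one_mul]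
  calc _ ≤ (1/2)^(2*n+1) * (1:ℝ) := by
        gcongr
        exact pow_le_one₀ (norm_nonneg q) hq.le
    _ ≤ (1/2)^n := by
        rw [mul_one]
        exact pow_le_pow_of_le_one (by norm_num) (by norm_num) (by omega)

lemma J_bound {q b : ℂ} (hq : ‖q‖ < 1) (hq0 : q ≠ 0) (h : Adm q b) (hb : ‖b‖ ≤ 1/2) (M : ℕ) :
    ‖(J q (b*q^M))⁻¹‖ ≤ ‖(J q b)⁻¹‖ := by
  induction M with
  | zero => simp
  | succ M ih =>
    refine le_trans ?_ ih
    have h' := h.mul_pow hq0 M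
    have := J_ne hq hq0 (h'.mul hq0)
    have hb' := h'.1
    rw [J_eq hq hq0 h']
    rw [show b*q^(M+1) = b*q^M*q by ring]
    have : (J q (b*q^M*q))⁻¹ = -(b*q^M) * (-(b*q^M) * J q (b*q^M*q))⁻¹ := by
      rw [mul_inv, mul_inv_cancel_left₀ (neg_ne_zero.2 hb')]
    rw [this, norm_mul, norm_neg]
    have := small_pow hq hb M
    calc _ ≤ 1 * ‖(-(b*q^M) * J q (b*q^M*q))⁻¹‖ := by
          gcongr
          linarith
      _ = _ := one_mul _

lemma D_bound {q b : ℂ} (hq : ‖q‖ < 1) (hq0 : q ≠ 0) (h : Adm q b) (hb : ‖b‖ ≤ 1/2) :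
    ∃ C : ℝ, ∀ M : ℕ, ‖D q (b*q^M)‖ ≤ C := by
  obtain ⟨C, hC⟩ := F_bound hq hq0 h hb
  refine ⟨C + (2 + 2 * ‖(J q b)⁻¹‖), fun M => ?_⟩
  have hM := small_pow hq hb M
  unfold D
  refine (norm_sub_le _ _).trans (add_le_add (hC M) ((norm_add_le _ _).trans
    (add_le_add (T_bound hq hM) ?_)))
  rw [div_eq_mul_inv, norm_mul]
  exact mul_le_mul (S_bound hq hM) (J_bound hq hq0 h hb M) (norm_nonneg _) (by norm_num)

lemma D_small {q b : ℂ} (hq : ‖q‖ < 1) (hq0 : q ≠ 0) (h : Adm q b) (hb : ‖b‖ ≤ 1/2) :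
    D q b = 0 := by
  obtain ⟨C, hC⟩ := D_bound hq hq0 h hb
  have key : ∀ M : ℕ, ‖D q b‖ ≤ (1/2)^M * ‖D q (b*q^M)‖ := by
    intro M
    induction M with
    | zero => simp
    | succ M ih =>
      refine ih.trans ?_
      rw [D_eq hq hq0 (h.mul_pow hq0 M), norm_mul (b*q^M*q), pow_succ, mul_assoc ((1/2)^M), pow_succ, ← mul_assoc b]
      have := small_pow hq hb (M+1)
      rw [pow_succ, ← mul_assoc] at this
      exact mul_le_mul_of_nonneg_left (mul_le_mul_of_nonneg_right this (norm_nonneg _))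
        (by positivity)
  have lim : Tendsto (fun M : ℕ => (1/2 : ℝ)^M * C) atTop (𝓝 (0 * C)) :=
    (tendsto_pow_atTop_nhds_zero_of_lt_one (by norm_num) (by norm_num)).mul_const C
  rw [zero_mul] at lim
  have := ge_of_tendsto' lim fun M => (key M).trans
    (mul_le_mul_of_nonneg_left (hC M) (by positivity))
  exact norm_le_zero_iff.1 this

lemma D_zero {q : ℂ} (hq : ‖q‖ < 1) (hq0 : q ≠ 0) (N : ℕ) :
    ∀ a, Adm q a → ‖a * q^N‖ ≤ 1/2 → D q a = 0 := by
  induction N with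
  | zero => intro a h hb; exact D_small hq hq0 h (by simpa using hb)
  | succ N ih =>
    intro a h hb
    rw [D_eq hq hq0 h, ih (a*q) (h.mul hq0) (by rwa [mul_assoc, ← pow_succ']), mul_zero]

end PT

/-- Ramanujan's partial theta identity \eqref{R2}. -/
theorem stmt_8 (q a : ℂ) (hq : ‖q‖ < 1) (hq0 : q ≠ 0) (ha : a ≠ 0)
    (ha' : ∀ n : ℤ, a ≠ q ^ n) :
    ∑' n : ℕ, qPoch q (q ^ 2) n * q ^ n / (qPoch a q (n + 1) * qPoch (q / a) q n)
      = (∑' n : ℕ, a ^ n * q ^ (n * (n + 1) / 2))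
        + (∑' n : ℕ, (-1 : ℂ) ^ n * a ^ (2 * n + 1) * q ^ (n * (n + 1)))
            / (qPochInf (-q) q * qPochInf a q * qPochInf (q / a) q) := by
  have h : PT.Adm q a := ⟨ha, ha'⟩
  have lim : Filter.Tendsto (fun N : ℕ => ‖a * q ^ N‖) Filter.atTop (nhds 0) := by
    simpa using ((tendsto_pow_atTop_nhds_zero_of_norm_lt_one hq).const_mul a).norm
  obtain ⟨N, hN⟩ := (lim.eventually_le_const (by norm_num : (0 : ℝ) < 1 / 2)).exists
  have := PT.D_zero hq hq0 N a h hN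
  exact sub_eq_zero.1 this
end

section
/- For |q|<1: 1 + 2 Σ_{n≥1} (q^n;q)_n q^n / (q;q)_n^3 = (1/(q;q)_∞^3) · Σ_{n≥0} (-1)^n q^{n(n+1)/2}. -/
open scoped BigOperators

lemma P_succ (q : ℂ) (n : ℕ) : qPoch q q (n+1) = qPoch q q n * (1 - q^(n+1)) := by
  simp [qPoch, Finset.prod_range_succ, pow_succ, mul_comm]

lemma P_zero (q : ℂ) : qPoch q q 0 = 1 := by simp [qPoch]

lemma one_sub_ne (q : ℂ) (hq : ‖q‖ < 1) (n : ℕ) : 1 - q^(n+1) ≠ 0 := by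
  intro h
  have h1 : q^(n+1) = 1 := (sub_eq_zero.mp h).symm
  have h2 : ‖q‖^(n+1) < 1 := pow_lt_one₀ (norm_nonneg _) hq (by omega)
  rw [← norm_pow, h1] at h2
  simp at h2

lemma P_ne (q : ℂ) (hq : ‖q‖ < 1) (n : ℕ) : qPoch q q n ≠ 0 := by
  induction n with
  | zero => simp [P_zero]
  | succ n ih => rw [P_succ]; exact mul_ne_zero ih (one_sub_ne q hq n)

lemma P_split (q : ℂ) (n : ℕ) :
    qPoch q q n * qPoch (q^(n+1)) q (n+1) = qPoch q q (2*n+1) := by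
  unfold qPoch
  rw [show 2*n+1 = n + (n+1) by ring, Finset.prod_range_add (fun j => 1 - q * q^j) n (n+1)]
  congr 1
  apply Finset.prod_congr rfl
  intro j _
  ring

/-- finite weights -/
noncomputable def gW (q : ℂ) (N k : ℕ) : ℂ :=
  if k ≤ N then qPoch q q (2*N+1) / (qPoch q q (N-k) * qPoch q q (N+1+k)) else 0

noncomputable def cW (q : ℂ) (N k : ℕ) : ℂ := (-1)^k * q^(k*(k+1)/2) * gW q N k

lemma tri_succ (k : ℕ) : (k+1)*(k+1+1)/2 = k*(k+1)/2 + (k+1) := by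
  rw [show (k+1)*(k+1+1) = k*(k+1) + (k+1)*2 by ring, Nat.add_mul_div_right _ _ (by norm_num)]

lemma gW_rec0 (q : ℂ) (hq : ‖q‖ < 1) (N : ℕ) :
    gW q (N+1) 0 = (1 + q^(2*(N+1))) * gW q N 0 + q^(N+1) * gW q N 0 + q^(N+2) * gW q N 1 := by
  rcases N with _ | N
  · have h1 := one_sub_ne q hq 0
    have h2 := one_sub_ne q hq 1
    simp [gW, P_succ, P_zero] at *
    field_simp
    ring
  · have e : 2*(N+1)+1 = 2*N+3 := by ring
    simp only [gW, show (0:ℕ) ≤ N+1+1 by omega, show (0:ℕ) ≤ N+1 by omega,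
      show 1 ≤ N+1 by omega, if_true, show N+1-1 = N by omega, Nat.sub_zero, Nat.add_zero,
      show 2*(N+1+1)+1 = 2*N+1+1+1+1+1 by ring, show 2*(N+1)+1 = 2*N+1+1+1 by ring, P_succ]
    have h0 := P_ne q hq N
    have h1 := one_sub_ne q hq N
    have h2 := one_sub_ne q hq (N+1)
    have h3 := one_sub_ne q hq (N+1+1)
    generalize qPoch q q (2*N) = x
    field_simp
    ring

lemma gW_rec (q : ℂ) (hq : ‖q‖ < 1) (N k : ℕ) (hk : k ≤ N) :
    gW q (N+1) (k+1) = (1 + q^(2*(N+1))) * gW q N (k+1) + q^(N-k) * gW q N k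
      + q^(N+3+k) * gW q N (k+2) := by
  obtain ⟨m, rfl⟩ := Nat.exists_eq_add_of_le hk
  rcases m with _ | _ | m
  · simp [gW]
    rw [show k+1+1+(k+1) = 2*(k+1)+1 by ring, show k+1+k = 2*k+1 by ring, P_zero]
    simp [P_ne q hq]
  · have h1 := one_sub_ne q hq 0
    simp only [gW, show k+1 ≤ k+(0+1)+1 by omega, show k+1 ≤ k+(0+1) by omega,
      show k ≤ k+(0+1) by omega, show ¬ (k+2 ≤ k+(0+1)) by omega, if_true, if_false,
      show k+(0+1)+1-(k+1) = 1 by omega, show k+(0+1)-(k+1) = 0 by omega,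
      show k+(0+1)-k = 1 by omega,
      show 2*(k+(0+1)+1)+1 = 2*k+1+1+1+1+1 by ring, show 2*(k+(0+1))+1 = 2*k+1+1+1 by ring,
      show k+(0+1)+1+1+(k+1) = 2*k+1+1+1+1 by ring, show k+(0+1)+1+(k+1) = 2*k+1+1+1 by ring,
      show k+(0+1)+1+k = 2*k+1+1 by ring, P_succ, P_zero]
    have h0 := P_ne q hq (2*k)
    have h2 := one_sub_ne q hq (2*k)
    have h3 := one_sub_ne q hq (2*k+1)
    have h4 := one_sub_ne q hq (2*k+1+1)
    have h5 := one_sub_ne q hq (2*k+1+1+1)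
    simp only [zero_add, pow_one] at *
    field_simp
    ring
  · simp only [gW, show k+1 ≤ k+(m+1+1)+1 by omega, show k+1 ≤ k+(m+1+1) by omega,
      show k ≤ k+(m+1+1) by omega, show (k+2 ≤ k+(m+1+1)) by omega, if_true,
      show k+(m+1+1)+1-(k+1) = m+1+1 by omega, show k+(m+1+1)-(k+1) = m+1 by omega,
      show k+(m+1+1)-k = m+1+1 by omega, show k+(m+1+1)-(k+2) = m by omega,
      show 2*(k+(m+1+1)+1)+1 = 2*k+2*m+5+1+1 by ring,
      show 2*(k+(m+1+1))+1 = 2*k+2*m+5 by ring,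
      show k+(m+1+1)+1+1+(k+1) = 2*k+m+3+1+1 by ring,
      show k+(m+1+1)+1+(k+1) = 2*k+m+3+1 by ring,
      show k+(m+1+1)+1+k = 2*k+m+3 by ring,
      show k+(m+1+1)+1+(k+2) = 2*k+m+3+1+1 by ring]
    rw [P_succ q (2*k+2*m+5+1), P_succ q (2*k+2*m+5), P_succ q (2*k+m+3+1), P_succ q (2*k+m+3),
      P_succ q (m+1), P_succ q m]
    have h0 := P_ne q hq m
    have h1 := P_ne q hq (2*k+m+3)
    have h2 := one_sub_ne q hq (m)
    have h3 := one_sub_ne q hq (m+1)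
    have h4 := one_sub_ne q hq (2*k+m+3)
    have h5 := one_sub_ne q hq (2*k+m+3+1)
    generalize qPoch q q (2*k+2*m+5) = x
    field_simp
    ring

lemma cW_rec0 (q : ℂ) (hq : ‖q‖ < 1) (N : ℕ) :
    cW q (N+1) 0 = (1 + q^(2*(N+1))) * cW q N 0 + q^(N+1) * cW q N 0 - q^(N+1) * cW q N 1 := by
  simp only [cW, gW_rec0 q hq N]
  norm_num
  ring

lemma cW_rec (q : ℂ) (hq : ‖q‖ < 1) (N k : ℕ) (hk : k ≤ N) :
    cW q (N+1) (k+1) = (1 + q^(2*(N+1))) * cW q N (k+1)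
      - q^(N+1) * cW q N k - q^(N+1) * cW q N (k+2) := by
  simp only [cW, gW_rec q hq N k hk]
  rw [tri_succ (k+1), tri_succ k]
  obtain ⟨m, rfl⟩ := Nat.exists_eq_add_of_le hk
  rw [Nat.add_sub_cancel_left]
  ring

lemma cW_top (q : ℂ) (N k : ℕ) (h : N < k) : cW q N k = 0 := by
  simp [cW, gW, show ¬ k ≤ N by omega]

noncomputable def SW (q : ℂ) (N : ℕ) : ℂ := ∑ k ∈ Finset.range (N+1), cW q N k

lemma SW_rec (q : ℂ) (hq : ‖q‖ < 1) (N : ℕ) :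
    SW q (N+1) = (1 - q^(N+1))^2 * SW q N + 2 * q^(N+1) * cW q N 0 := by
  have e1 : ∑ k ∈ Finset.range (N+1), cW q N (k+1) = SW q N - cW q N 0 := by
    have := Finset.sum_range_succ' (cW q N) (N+1)
    rw [Finset.sum_range_succ, cW_top q N (N+1) (by omega)] at this
    unfold SW
    linear_combination -this
  have e2 : ∑ k ∈ Finset.range (N+1), cW q N (k+2) = SW q N - cW q N 0 - cW q N 1 := by
    have := Finset.sum_range_succ' (fun k => cW q N (k+1)) (N+1)
    rw [Finset.sum_range_succ, cW_top q N (N+1+1) (by omega), e1] at this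
    simp only [zero_add] at this
    linear_combination -this
  have : SW q (N+1) = ∑ k ∈ Finset.range (N+1), cW q (N+1) (k+1) + cW q (N+1) 0 := by
    unfold SW
    rw [Finset.sum_range_succ']
  rw [this, Finset.sum_congr rfl (fun k hk => cW_rec q hq N k (by simp at hk; omega)),
    Finset.sum_sub_distrib, Finset.sum_sub_distrib, ← Finset.mul_sum, ← Finset.mul_sum,
    ← Finset.mul_sum, e1, e2, cW_rec0 q hq]
  change _ * _ - _ * SW q N - _ + _ = _
  ring

lemma finite_id (q : ℂ) (hq : ‖q‖ < 1) (N : ℕ) :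
    1 + 2 * ∑ n ∈ Finset.range N,
      qPoch (q ^ (n + 1)) q (n + 1) * q ^ (n + 1) / (qPoch q q (n + 1)) ^ 3
    = SW q N / (qPoch q q N)^2 := by
  induction N with
  | zero => simp [SW, cW, gW, P_zero, P_ne q hq]
  | succ N ih =>
    rw [Finset.sum_range_succ, mul_add, ← add_assoc, ih, SW_rec q hq]
    have h0 := P_ne q hq N
    have h1 := one_sub_ne q hq N
    have : cW q N 0 = qPoch (q ^ (N + 1)) q (N + 1) / qPoch q q (N+1) := by
      simp [cW, gW, ← P_split]
      field_simp
    rw [this, P_succ]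
    field_simp

lemma summ_aux (q : ℂ) (hq : ‖q‖ < 1) : Summable (fun j : ℕ => ‖-(q * q^j)‖) := by
  simpa [norm_mul, norm_pow] using
    (summable_geometric_of_lt_one (norm_nonneg q) hq).mul_left ‖q‖

lemma P_tendsto (q : ℂ) (hq : ‖q‖ < 1) :
    Filter.Tendsto (fun n => qPoch q q n) Filter.atTop (nhds (qPochInf q q)) := by
  have h := multipliable_one_add_of_summable (summ_aux q hq)
  simp only [← sub_eq_add_neg] at h
  exact h.tendsto_prod_tprod_nat

lemma PInf_ne (q : ℂ) (hq : ‖q‖ < 1) : qPochInf q q ≠ 0 := by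
  have h := tprod_one_add_ne_zero_of_summable (f := fun j : ℕ => -(q * q^j)) (fun i => by
    have := one_sub_ne q hq i
    rwa [pow_succ', sub_eq_add_neg] at this) (summ_aux q hq)
  simp only [← sub_eq_add_neg] at h
  exact h

lemma bdd_aux (u : ℕ → ℂ) (x : ℂ) (h : Filter.Tendsto u Filter.atTop (nhds x)) :
    ∃ A : ℝ, 0 ≤ A ∧ ∀ n, ‖u n‖ ≤ A := by
  obtain ⟨A, hA⟩ := (Metric.isBounded_range_of_tendsto u h).exists_norm_le
  exact ⟨A, (norm_nonneg _).trans (hA (u 0) ⟨0, rfl⟩), fun n => hA _ ⟨n, rfl⟩⟩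

lemma tri_ge (k : ℕ) : k ≤ k*(k+1)/2 := by
  rcases k with _ | k
  · simp
  · rw [tri_succ]; omega

lemma SW_tendsto (q : ℂ) (hq : ‖q‖ < 1) :
    Filter.Tendsto (SW q) Filter.atTop
      (nhds (∑' n : ℕ, (-1 : ℂ) ^ n * q ^ (n * (n + 1) / 2) * (qPochInf q q)⁻¹)) := by
  obtain ⟨A, hA0, hA⟩ := bdd_aux _ _ (P_tendsto q hq)
  obtain ⟨B, hB0, hB⟩ := bdd_aux _ _ ((P_tendsto q hq).inv₀ (PInf_ne q hq))
  have e : SW q = fun N => ∑' k, cW q N k := by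
    funext N
    rw [tsum_eq_sum (s := Finset.range (N+1))]
    · rfl
    · intro k hk
      exact cW_top q N k (by simp at hk; omega)
  rw [e]
  apply tendsto_tsum_of_dominated_convergence (bound := fun k => ‖q‖^k * (A * (B * B)))
  · exact (summable_geometric_of_lt_one (norm_nonneg q) hq).mul_right _
  · intro k
    have hP := P_tendsto q hq
    have hI := PInf_ne q hq
    have t1 : Filter.Tendsto (fun N => 2*N+1) Filter.atTop (Filter.atTop : Filter ℕ) :=
      Filter.tendsto_atTop_mono (fun N => by simp only [id]; omega) Filter.tendsto_id
    have t2 : Filter.Tendsto (fun N => N-k) Filter.atTop (Filter.atTop : Filter ℕ) :=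
      Filter.tendsto_sub_atTop_nat k
    have t3 : Filter.Tendsto (fun N => N+1+k) Filter.atTop (Filter.atTop : Filter ℕ) :=
      Filter.tendsto_atTop_mono (fun N => by simp only [id]; omega) Filter.tendsto_id
    have h := (hP.comp t1).div ((hP.comp t2).mul (hP.comp t3)) (mul_ne_zero hI hI)
    have e2 : qPochInf q q / (qPochInf q q * qPochInf q q) = (qPochInf q q)⁻¹ := by
      field_simp
    rw [e2] at h
    apply Filter.Tendsto.const_mul
    refine h.congr' ?_
    filter_upwards [Filter.eventually_ge_atTop k] with N hN
    simp [gW, hN]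
  · refine Filter.Eventually.of_forall fun N k => ?_
    have hb : ‖gW q N k‖ ≤ A * (B * B) := by
      unfold gW
      split_ifs
      · rw [div_eq_mul_inv, mul_inv, norm_mul, norm_mul]
        exact mul_le_mul (hA _) (mul_le_mul (hB _) (hB _) (norm_nonneg _) hB0)
          (by positivity) hA0
      · simp; positivity
    unfold cW
    rw [norm_mul, norm_mul, norm_pow, norm_neg, norm_one, one_pow, one_mul, norm_pow]
    exact mul_le_mul (pow_le_pow_of_le_one (norm_nonneg _) hq.le (tri_ge k)) hb
      (norm_nonneg _) (by positivity)

lemma lhs_summable (q : ℂ) (hq : ‖q‖ < 1) : Summable (fun n : ℕ =>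
    qPoch (q ^ (n + 1)) q (n + 1) * q ^ (n + 1) / (qPoch q q (n + 1)) ^ 3) := by
  obtain ⟨A, hA0, hA⟩ := bdd_aux _ _ (P_tendsto q hq)
  obtain ⟨B, hB0, hB⟩ := bdd_aux _ _ ((P_tendsto q hq).inv₀ (PInf_ne q hq))
  refine Summable.of_norm_bounded (g := fun n => ‖q‖^n * (‖q‖ * (A * B * B^3)))
    ((summable_geometric_of_lt_one (norm_nonneg q) hq).mul_right _) fun n => ?_
  have e : qPoch (q ^ (n + 1)) q (n + 1) * q ^ (n + 1) / (qPoch q q (n + 1)) ^ 3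
      = q^n * (q * (qPoch q q (2*n+1) * (qPoch q q n)⁻¹ * ((qPoch q q (n+1))⁻¹)^3)) := by
    rw [← P_split]
    have := P_ne q hq n
    have := P_ne q hq (n+1)
    field_simp
    ring
  rw [e]
  simp only [norm_mul, norm_pow]
  gcongr
  · exact hA _
  · exact hB _
  · exact hB _

/-- Identity \eqref{a1}. -/
theorem stmt_12 (q : ℂ) (hq : ‖q‖ < 1) :
    1 + 2 * ∑' n : ℕ, qPoch (q ^ (n + 1)) q (n + 1) * q ^ (n + 1) / (qPoch q q (n + 1)) ^ 3
      = (∑' n : ℕ, (-1 : ℂ) ^ n * q ^ (n * (n + 1) / 2)) / (qPochInf q q) ^ 3 := by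
  have hI := PInf_ne q hq
  have h1 := ((lhs_summable q hq).hasSum.tendsto_sum_nat.const_mul 2).const_add 1
  have h2 := (SW_tendsto q hq).div ((P_tendsto q hq).pow 2) (pow_ne_zero 2 hI)
  have h3 := tendsto_nhds_unique h1 (h2.congr fun N => (finite_id q hq N).symm)
  rw [h3, tsum_mul_right]
  field_simp
end

section
/- First residual identity: Σ_{n≥0} (a^2 q^{n+1};q)_n q^n / ((q;q)_n (aq;q)_n) = (1/((q;q)_∞ (aq;q)_∞)) · Σ_{n≥0} a^{3n} q^{n(3n+2)} (1 - a q^{2n+1}), for |q|<1 and |a| small (or as formal power series in a and q). -/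
open scoped BigOperators

open Filter Topology

namespace RA

/-- certificate polynomial -/
noncomputable def cert (a q u : ℂ) : ℂ :=
  (1 - a * q) - (a * q + a ^ 2 * q ^ 3) * u + a ^ 3 * q ^ 2 * (1 + q + q ^ 2) * u ^ 2
    - a ^ 4 * q ^ 3 * u ^ 3 + a ^ 6 * q ^ 6 * u ^ 4 - a ^ 7 * q ^ 7 * u ^ 5

lemma cert_step (a q u : ℂ) :
    cert a q (u * q) * (1 - a ^ 2 * q * u ^ 2) * (1 - a ^ 2 * q ^ 2 * u ^ 2)
      = cert a q u * (1 - a ^ 2 * q ^ 4 * u) * (1 - u) * (1 - a * q ^ 2 * u)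
        + u * ((1 - a * q * u) * (1 - a * q ^ 2 * u) * ((1 - a ^ 2 * q * u) *
          (1 - a ^ 2 * q ^ 2 * u) * (1 - a ^ 2 * q ^ 3 * u) * (1 - a ^ 2 * q ^ 4 * u))
        - a ^ 3 * q ^ 5 * ((1 - a ^ 2 * q * u ^ 2) *
          (1 - a ^ 2 * q ^ 2 * u ^ 2) * (1 - a ^ 2 * q ^ 3 * u ^ 2) *
          (1 - a ^ 2 * q ^ 4 * u ^ 2))) := by
  unfold cert; ring

lemma qPoch_succ (x q : ℂ) (n : ℕ) : qPoch x q (n + 1) = qPoch x q n * (1 - x * q ^ n) := by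
  simp [qPoch, Finset.prod_range_succ]

lemma qPoch_zero (x q : ℂ) : qPoch x q 0 = 1 := by simp [qPoch]

lemma qPoch_add (x q : ℂ) (m n : ℕ) :
    qPoch x q (m + n) = qPoch x q m * qPoch (x * q ^ m) q n := by
  simp only [qPoch, Finset.prod_range_add]
  congr 1
  refine Finset.prod_congr rfl fun j _ => ?_
  ring

lemma fac_ne {x q : ℂ} (hq : ‖q‖ < 1) (hx : ‖x‖ < 1) (j : ℕ) : 1 - x * q ^ j ≠ 0 := by
  intro h
  have h1 : x * q ^ j = 1 := (sub_eq_zero.mp h).symm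
  have h2 : ‖x * q ^ j‖ < 1 := by
    rw [norm_mul, norm_pow]
    calc ‖x‖ * ‖q‖ ^ j ≤ ‖x‖ * 1 := by
          gcongr; exact pow_le_one₀ (norm_nonneg _) hq.le
      _ < 1 := by simpa using hx
  rw [h1] at h2
  simp at h2

lemma qPoch_ne {x q : ℂ} (hq : ‖q‖ < 1) (hx : ‖x‖ < 1) (n : ℕ) : qPoch x q n ≠ 0 :=
  Finset.prod_ne_zero_iff.mpr fun j _ => fac_ne hq hx j

lemma summ {x q : ℂ} (hq : ‖q‖ < 1) : Summable fun j : ℕ => ‖-(x * q ^ j)‖ := by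
  simp only [norm_neg, norm_mul, norm_pow]
  exact (summable_geometric_of_lt_one (norm_nonneg _) hq).mul_left _

lemma qPoch_tendsto {x q : ℂ} (hq : ‖q‖ < 1) :
    Tendsto (qPoch x q) atTop (𝓝 (qPochInf x q)) := by
  have := (multipliable_one_add_of_summable (summ (x := x) hq)).tendsto_prod_tprod_nat
  have e : qPoch x q = fun n => ∏ j ∈ Finset.range n, (1 + -(x * q ^ j)) := by
    funext n; simp [qPoch, sub_eq_add_neg]
  rw [e]
  simpa [qPochInf, sub_eq_add_neg] using this

lemma qPochInf_ne {x q : ℂ} (hq : ‖q‖ < 1) (hx : ‖x‖ < 1) : qPochInf x q ≠ 0 := by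
  have := tprod_one_add_ne_zero_of_summable (f := fun j : ℕ => -(x * q ^ j))
    (fun j => by simpa [sub_eq_add_neg] using fac_ne hq hx j) (summ hq)
  simpa [qPochInf, sub_eq_add_neg] using this

lemma qPochInf_shift {x q : ℂ} (hq : ‖q‖ < 1) (m : ℕ) :
    qPochInf x q = qPoch x q m * qPochInf (x * q ^ m) q := by
  have h1 := (qPoch_tendsto (x := x) hq).comp (tendsto_add_atTop_nat m)
  have h2 := (qPoch_tendsto (x := x * q ^ m) hq).const_mul (qPoch x q m)
  refine tendsto_nhds_unique h1 (h2.congr fun n => ?_)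
  simp [add_comm n m, qPoch_add]

/-- summand -/
noncomputable def t (q a : ℂ) (n : ℕ) : ℂ :=
  qPoch (a ^ 2 * q ^ (n + 1)) q n * q ^ n / (qPoch q q n * qPoch (a * q) q n)

lemma nx {q a : ℂ} (hq : ‖q‖ < 1) (ha : ‖a‖ < 1) : ‖a * q‖ < 1 := by
  rw [norm_mul]; nlinarith [norm_nonneg a, norm_nonneg q]

lemma na2 {a : ℂ} (ha : ‖a‖ < 1) : ‖a ^ 2‖ < 1 := by
  rw [norm_pow]; exact pow_lt_one₀ (norm_nonneg _) ha (by norm_num)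

lemma t_eq {q a : ℂ} (hq : ‖q‖ < 1) (ha : ‖a‖ < 1) (n : ℕ) :
    t q a n = qPoch (a ^ 2 * q) q (2 * n) * q ^ n /
      (qPoch (a ^ 2 * q) q n * qPoch q q n * qPoch (a * q) q n) := by
  have h1 := qPoch_ne hq (nx hq (na2 ha)) n
  have h2 := qPoch_ne hq hq n
  have h3 := qPoch_ne hq (nx hq ha) n
  rw [two_mul, qPoch_add, t, show a ^ 2 * q * q ^ n = a ^ 2 * q ^ (n + 1) by ring]
  field_simp

lemma t_shift {q a : ℂ} (hq : ‖q‖ < 1) (ha : ‖a‖ < 1) (n : ℕ) :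
    t q (a * q ^ 2) n / ((1 - a * q) * (1 - a * q ^ 2)) =
      qPoch (a ^ 2 * q) q (2 * n + 4) * q ^ n /
      (qPoch (a ^ 2 * q) q (n + 4) * qPoch q q n * qPoch (a * q) q (n + 2)) := by
  have h1 := qPoch_ne hq (nx hq (na2 ha)) (n + 4)
  have h2 := qPoch_ne hq hq n
  have e1 : qPoch (a * q) q (n + 2) =
      (1 - a * q) * (1 - a * q ^ 2) * qPoch (a * q ^ 2 * q) q n := by
    rw [add_comm, qPoch_add, qPoch_succ, qPoch_succ, qPoch_zero]
    congr 1
    · ring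
    · congr 1; ring
  have h3 := qPoch_ne hq (nx hq ha) (n + 2)
  rw [e1] at h3
  rw [e1, show 2 * n + 4 = (n + 4) + n by ring, qPoch_add, t,
    show a ^ 2 * q * q ^ (n + 4) = (a * q ^ 2) ^ 2 * q ^ (n + 1) by ring]
  have h4 := left_ne_zero_of_mul h3
  have h5 := right_ne_zero_of_mul h3
  have h6 := left_ne_zero_of_mul h4
  have h7 := right_ne_zero_of_mul h4
  field_simp

lemma tele {q a : ℂ} (hq : ‖q‖ < 1) (ha : ‖a‖ < 1) (N : ℕ) :
    ∑ n ∈ Finset.range (N + 1),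
      (t q a n - a ^ 3 * q ^ 5 * (t q (a * q ^ 2) n / ((1 - a * q) * (1 - a * q ^ 2))))
    = cert a q (q ^ (N + 1)) * qPoch (a ^ 2 * q) q (2 * N + 2) /
      (qPoch (a ^ 2 * q) q (N + 4) * qPoch q q N * qPoch (a * q) q (N + 2)) := by
  have hA := fac_ne hq (nx hq (na2 ha))
  have hB := fac_ne hq (nx hq ha)
  have hQ := fac_ne hq hq
  induction N with
  | zero =>
    rw [zero_add, Finset.sum_range_one, t_eq hq ha, t_shift hq ha]
    have g1 := qPoch_ne hq (nx hq (na2 ha)) 4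
    have g2 := qPoch_ne hq (nx hq ha) 2
    have key : cert a q q * qPoch (a ^ 2 * q) q 2
        = qPoch (a ^ 2 * q) q 4 * (qPoch (a * q) q 2 - a ^ 3 * q ^ 5) := by
      simp only [qPoch_succ, qPoch_zero, cert]
      ring
    simp only [Nat.mul_zero, Nat.zero_add, qPoch_zero, pow_zero, pow_one, mul_one, one_mul, div_one]
    rw [key]
    field_simp
  | succ N ih =>
    rw [Finset.sum_range_succ, ih, t_eq hq ha, t_shift hq ha]
    have g1 := qPoch_ne hq (nx hq (na2 ha)) (N + 1)
    have g2 := qPoch_ne hq (nx hq ha) (N + 1)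
    have g3 := qPoch_ne hq hq N
    have c := cert_step a q (q ^ (N + 1))
    have e1 : 2 * (N + 1) + 4 = 2 * N + 2 + 1 + 1 + 1 + 1 := by ring
    have e2 : 2 * (N + 1) + 2 = 2 * N + 2 + 1 + 1 := by ring
    have e3 : 2 * (N + 1) = 2 * N + 2 := by ring
    have e4 : N + 1 + 4 = N + 1 + 1 + 1 + 1 + 1 := by ring
    have e5 : N + 4 = N + 1 + 1 + 1 + 1 := by ring
    have e6 : N + 1 + 2 = N + 1 + 1 + 1 := by ring
    have e7 : N + 2 = N + 1 + 1 := by ring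
    rw [e1, e2, e3, e4, e5, e6, e7, qPoch_succ q q N]
    simp only [qPoch_succ _ _ (2 * N + 2), qPoch_succ _ _ (2 * N + 2 + 1),
      qPoch_succ _ _ (2 * N + 2 + 1 + 1), qPoch_succ _ _ (2 * N + 2 + 1 + 1 + 1),
      qPoch_succ _ _ (N + 1), qPoch_succ _ _ (N + 1 + 1),
      qPoch_succ _ _ (N + 1 + 1 + 1), qPoch_succ _ _ (N + 1 + 1 + 1 + 1)]
    generalize qPoch (a ^ 2 * q) q (2 * N + 2) = X
    generalize qPoch (a ^ 2 * q) q (N + 1) = Y at *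
    generalize qPoch (a * q) q (N + 1) = W at *
    generalize qPoch q q N = Z at *
    have d1 : 1 - a ^ 2 * q * q ^ (N + 1) = 1 - a ^ 2 * q * q ^ (N + 1) := rfl
    have d2 : 1 - a ^ 2 * q * q ^ (N + 1 + 1) = 1 - a ^ 2 * q ^ 2 * q ^ (N + 1) := by ring
    have d3 : 1 - a ^ 2 * q * q ^ (N + 1 + 1 + 1) = 1 - a ^ 2 * q ^ 3 * q ^ (N + 1) := by ring
    have d4 : 1 - a ^ 2 * q * q ^ (N + 1 + 1 + 1 + 1) = 1 - a ^ 2 * q ^ 4 * q ^ (N + 1) := by ring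
    have d5 : 1 - a * q * q ^ (N + 1 + 1) = 1 - a * q ^ 2 * q ^ (N + 1) := by ring
    have d6 : 1 - q * q ^ N = 1 - q ^ (N + 1) := by ring
    have d7 : 1 - a ^ 2 * q * q ^ (2 * N + 2) = 1 - a ^ 2 * q * (q ^ (N + 1)) ^ 2 := by ring
    have d8 : 1 - a ^ 2 * q * q ^ (2 * N + 2 + 1) = 1 - a ^ 2 * q ^ 2 * (q ^ (N + 1)) ^ 2 := by ring
    have d9 : 1 - a ^ 2 * q * q ^ (2 * N + 2 + 1 + 1) = 1 - a ^ 2 * q ^ 3 * (q ^ (N + 1)) ^ 2 := by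
      ring
    have d10 : 1 - a ^ 2 * q * q ^ (2 * N + 2 + 1 + 1 + 1)
      = 1 - a ^ 2 * q ^ 4 * (q ^ (N + 1)) ^ 2 := by ring
    have p1 := hA (N + 1)
    have p2 := hA (N + 1 + 1)
    have p3 := hA (N + 1 + 1 + 1)
    have p4 := hA (N + 1 + 1 + 1 + 1)
    have p5 := hB (N + 1)
    have p6 := hB (N + 1 + 1)
    have p7 := hQ N
    rw [d2] at p2
    rw [d3] at p3
    rw [d4] at p4
    rw [d5] at p6
    rw [d6] at p7
    rw [d2, d3, d4, d5, d6, d7, d8, d9, d10, pow_succ q (N + 1)]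
    generalize q ^ (N + 1) = u at *
    generalize hC : cert a q u = C at *
    generalize hC' : cert a q (u * q) = C' at *
    clear ih d1 d2 d3 d4 d5 d6 d7 d8 d9 d10 e1 e2 e3 e4 e5 e6 e7 hA hB hQ hC hC'
    generalize 1 - a ^ 2 * q * u = A1 at *
    generalize 1 - a ^ 2 * q ^ 2 * u = A2 at *
    generalize 1 - a ^ 2 * q ^ 3 * u = A3 at *
    generalize 1 - a ^ 2 * q ^ 4 * u = A4 at *
    generalize 1 - a * q * u = B1 at *
    generalize 1 - a * q ^ 2 * u = B2 at *
    generalize 1 - u = U at *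
    generalize 1 - a ^ 2 * q * u ^ 2 = V1 at *
    generalize 1 - a ^ 2 * q ^ 2 * u ^ 2 = V2 at *
    generalize 1 - a ^ 2 * q ^ 3 * u ^ 2 = V3 at *
    generalize 1 - a ^ 2 * q ^ 4 * u ^ 2 = V4 at *
    rw [eq_div_iff (by simp [*])]
    trans X * (C' * V1 * V2)
    · rw [c]; field_simp
    · ring

lemma upper {q : ℂ} (hq : ‖q‖ < 1) :
    ∃ B : ℝ, 0 < B ∧ ∀ x : ℂ, ‖x‖ ≤ 1 → ∀ n, ‖qPoch x q n‖ ≤ B := by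
  have hr : ‖((‖q‖ : ℝ) : ℂ)‖ < 1 := by simpa using hq
  obtain ⟨B, hB⟩ := (qPoch_tendsto (x := -1) hr).norm.bddAbove_range
  refine ⟨max B 1, by positivity, fun x hx n => le_max_of_le_left (le_trans ?_ (hB ⟨n, rfl⟩))⟩
  simp only [qPoch, norm_prod]
  refine Finset.prod_le_prod (fun _ _ => norm_nonneg _) fun j _ => ?_
  have h1 : ‖(1 : ℂ) - -1 * ((‖q‖ : ℝ) : ℂ) ^ j‖ = 1 + ‖q‖ ^ j := by
    rw [show (1 : ℂ) - -1 * ((‖q‖ : ℝ) : ℂ) ^ j = ((1 + ‖q‖ ^ j : ℝ) : ℂ) by push_cast; ring,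
      Complex.norm_real, Real.norm_of_nonneg (by positivity)]
  rw [h1]
  calc ‖1 - x * q ^ j‖ ≤ ‖(1 : ℂ)‖ + ‖x * q ^ j‖ := norm_sub_le _ _
    _ = 1 + ‖x‖ * ‖q‖ ^ j := by simp
    _ ≤ 1 + 1 * ‖q‖ ^ j := by gcongr
    _ = _ := by ring

lemma lower {q : ℂ} (hq : ‖q‖ < 1) :
    ∃ D : ℝ, 0 < D ∧ ∀ x : ℂ, ‖x‖ ≤ ‖q‖ → ∀ n, ‖qPoch x q n‖⁻¹ ≤ D := by
  have hr : ‖((‖q‖ : ℝ) : ℂ)‖ < 1 := by simpa using hq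
  obtain ⟨B, hB⟩ := ((qPoch_tendsto (x := ((‖q‖ : ℝ) : ℂ)) hr).norm.inv₀
    (norm_ne_zero_iff.mpr (qPochInf_ne hr hr))).bddAbove_range
  refine ⟨max B 1, by positivity, fun x hx n => le_max_of_le_left (le_trans ?_ (hB ⟨n, rfl⟩))⟩
  have hp : 0 < ‖qPoch ((‖q‖ : ℝ) : ℂ) ((‖q‖ : ℝ) : ℂ) n‖ := norm_pos_iff.mpr (qPoch_ne hr hr n)
  refine inv_anti₀ hp ?_
  simp only [qPoch, norm_prod]
  refine Finset.prod_le_prod (fun _ _ => norm_nonneg _) fun j _ => ?_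
  have hle : ‖q‖ * ‖q‖ ^ j ≤ 1 := by
    rw [← pow_succ']; exact pow_le_one₀ (norm_nonneg _) hq.le
  have h1 : ‖(1 : ℂ) - ((‖q‖ : ℝ) : ℂ) * ((‖q‖ : ℝ) : ℂ) ^ j‖ = 1 - ‖q‖ * ‖q‖ ^ j := by
    rw [show (1 : ℂ) - ((‖q‖ : ℝ) : ℂ) * ((‖q‖ : ℝ) : ℂ) ^ j
      = ((1 - ‖q‖ * ‖q‖ ^ j : ℝ) : ℂ) by push_cast; ring,
      Complex.norm_real, Real.norm_of_nonneg (by linarith)]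
  rw [h1]
  calc 1 - ‖q‖ * ‖q‖ ^ j ≤ 1 - ‖x‖ * ‖q‖ ^ j := by gcongr
    _ = ‖(1 : ℂ)‖ - ‖x * q ^ j‖ := by simp
    _ ≤ _ := norm_sub_norm_le _ _

lemma t_bound {q : ℂ} (hq : ‖q‖ < 1) :
    ∃ C : ℝ, 0 < C ∧ ∀ a : ℂ, ‖a‖ < 1 → ∀ n, ‖t q a n‖ ≤ C * ‖q‖ ^ n := by
  obtain ⟨B, hB0, hB⟩ := upper hq
  obtain ⟨D, hD0, hD⟩ := lower hq
  refine ⟨B * (D * D), by positivity, fun a ha n => ?_⟩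
  have h1 := hB (a ^ 2 * q ^ (n + 1)) (by
    rw [norm_mul, norm_pow q]
    exact mul_le_one₀ (na2 ha).le (by positivity) (pow_le_one₀ (norm_nonneg _) hq.le)) n
  have h2 := hD q le_rfl n
  have h3 := hD (a * q) (by
    rw [norm_mul]; exact mul_le_of_le_one_left (norm_nonneg _) ha.le) n
  rw [t, norm_div, norm_mul, norm_mul, norm_pow, div_eq_mul_inv, mul_inv]
  calc _ ≤ B * ‖q‖ ^ n * (D * D) := by gcongr
    _ = _ := by ring

lemma t_summable {q a : ℂ} (hq : ‖q‖ < 1) (ha : ‖a‖ < 1) : Summable (t q a) := by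
  obtain ⟨C, _, hC⟩ := t_bound hq
  exact Summable.of_norm_bounded
    ((summable_geometric_of_lt_one (norm_nonneg _) hq).mul_left C) (hC a ha)

/-- normalized sum -/
noncomputable def f (q a : ℂ) : ℂ := qPochInf q q * qPochInf (a * q) q * ∑' n, t q a n

lemma f_bound {q : ℂ} (hq : ‖q‖ < 1) : ∃ M : ℝ, ∀ a : ℂ, ‖a‖ < 1 → ‖f q a‖ ≤ M := by
  obtain ⟨C, hC0, hC⟩ := t_bound hq
  obtain ⟨B, hB0, hB⟩ := upper hq
  have hI : ∀ x : ℂ, ‖x‖ ≤ 1 → ‖qPochInf x q‖ ≤ B := fun x hx =>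
    le_of_tendsto (qPoch_tendsto hq).norm (Eventually.of_forall (hB x hx))
  refine ⟨B * B * (∑' n : ℕ, C * ‖q‖ ^ n), fun a ha => ?_⟩
  have h3 := tsum_of_norm_bounded
    ((summable_geometric_of_lt_one (norm_nonneg _) hq).mul_left C).hasSum (hC a ha)
  have h1 := hI q hq.le
  have h2 := hI (a * q) (nx hq ha).le
  rw [f, norm_mul, norm_mul]
  gcongr

lemma nx2 {q a : ℂ} (hq : ‖q‖ < 1) (ha : ‖a‖ < 1) : ‖a * q ^ 2‖ < 1 := by
  have := nx hq (nx hq ha)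
  rwa [mul_assoc, ← pow_two] at this

lemma f_rec {q a : ℂ} (hq : ‖q‖ < 1) (ha : ‖a‖ < 1) :
    f q a = (1 - a * q) + a ^ 3 * q ^ 5 * f q (a * q ^ 2) := by
  have s1 := t_summable hq ha
  have s2 := t_summable hq (nx2 hq ha)
  have hs := (s1.hasSum.sub ((s2.hasSum.div_const
    ((1 - a * q) * (1 - a * q ^ 2))).mul_left (a ^ 3 * q ^ 5))).tendsto_sum_nat.comp
      (tendsto_add_atTop_nat 1)
  have hp : Tendsto (fun N : ℕ => q ^ (N + 1)) atTop (𝓝 0) :=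
    (tendsto_pow_atTop_nhds_zero_of_norm_lt_one hq).comp (tendsto_add_atTop_nat 1)
  have hc : Tendsto (fun N : ℕ => cert a q (q ^ (N + 1))) atTop (𝓝 (1 - a * q)) := by
    have : Continuous (cert a q) := by unfold cert; fun_prop
    have h := (this.tendsto 0).comp hp
    have e0 : cert a q 0 = 1 - a * q := by simp [cert]
    rw [e0] at h
    exact h
  have hA := qPochInf_ne hq (nx hq (na2 ha))
  have hB := qPochInf_ne hq (nx hq ha)
  have hQ := qPochInf_ne hq hq
  have hA1 : Tendsto (fun N : ℕ => qPoch (a ^ 2 * q) q (2 * N + 2)) atTop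
      (𝓝 (qPochInf (a ^ 2 * q) q)) :=
    (qPoch_tendsto hq).comp (tendsto_atTop_mono (fun N => by simp only [id]; omega) tendsto_id)
  have hA2 : Tendsto (fun N : ℕ => qPoch (a ^ 2 * q) q (N + 4)) atTop
      (𝓝 (qPochInf (a ^ 2 * q) q)) :=
    (qPoch_tendsto hq).comp (tendsto_add_atTop_nat 4)
  have hB1 : Tendsto (fun N : ℕ => qPoch (a * q) q (N + 2)) atTop
      (𝓝 (qPochInf (a * q) q)) :=
    (qPoch_tendsto hq).comp (tendsto_add_atTop_nat 2)
  have hl := (hc.mul hA1).div ((hA2.mul (qPoch_tendsto (x := q) hq)).mul hB1)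
    (mul_ne_zero (mul_ne_zero hA hQ) hB)
  have heq := tendsto_nhds_unique hs (hl.congr fun N => (tele hq ha N).symm)
  have e : qPochInf (a * q) q =
      (1 - a * q) * (1 - a * q ^ 2) * qPochInf (a * q ^ 2 * q) q := by
    rw [qPochInf_shift hq 2, qPoch_succ, qPoch_succ, qPoch_zero]
    congr 1
    · ring
    · congr 1; ring
  have h3 := hB
  rw [e] at h3
  have h4 := left_ne_zero_of_mul h3
  have h5 := right_ne_zero_of_mul h3
  have heq2 : ∑' n, t q a n = (1 - a * q) / (qPochInf q q * qPochInf (a * q) q)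
      + a ^ 3 * q ^ 5 * ((∑' n, t q (a * q ^ 2) n) / ((1 - a * q) * (1 - a * q ^ 2))) := by
    rw [sub_eq_iff_eq_add] at heq
    rw [heq]
    congr 1
    field_simp
  rw [f, f, heq2, mul_add]
  congr 1
  · field_simp
  · rw [e]
    generalize (1 - a * q) * (1 - a * q ^ 2) = z at *
    field_simp

lemma nxm {q a : ℂ} (hq : ‖q‖ < 1) (ha : ‖a‖ < 1) (m : ℕ) : ‖a * q ^ m‖ < 1 := by
  rw [norm_mul, norm_pow]
  exact lt_of_le_of_lt (mul_le_of_le_one_right (norm_nonneg _)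
    (pow_le_one₀ (norm_nonneg _) hq.le)) ha

lemma f_iter {q a : ℂ} (hq : ‖q‖ < 1) (ha : ‖a‖ < 1) (N : ℕ) :
    f q a = ∑ n ∈ Finset.range N, a ^ (3 * n) * q ^ (n * (3 * n + 2)) * (1 - a * q ^ (2 * n + 1))
      + a ^ (3 * N) * q ^ (N * (3 * N + 2)) * f q (a * q ^ (2 * N)) := by
  induction N with
  | zero => simp
  | succ N ih =>
    rw [Finset.sum_range_succ, ih, f_rec hq (nxm hq ha (2 * N)),
      show a * q ^ (2 * N) * q ^ 2 = a * q ^ (2 * (N + 1)) by ring]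
    ring

lemma rhs_summable {q a : ℂ} (hq : ‖q‖ < 1) (ha : ‖a‖ < 1) :
    Summable fun n : ℕ => a ^ (3 * n) * q ^ (n * (3 * n + 2)) * (1 - a * q ^ (2 * n + 1)) := by
  have h3 : ‖a‖ ^ 3 < 1 := pow_lt_one₀ (norm_nonneg _) ha (by norm_num)
  refine Summable.of_norm_bounded
    ((summable_geometric_of_lt_one (by positivity) h3).mul_right 2) fun n => ?_
  rw [norm_mul, norm_mul, norm_pow, norm_pow, pow_mul]
  have h1 : ‖1 - a * q ^ (2 * n + 1)‖ ≤ 2 := by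
    have h := norm_sub_le (1 : ℂ) (a * q ^ (2 * n + 1))
    have h' := nxm hq ha (2 * n + 1)
    simp only [norm_one] at h
    linarith
  have h2 : ‖q‖ ^ (n * (3 * n + 2)) ≤ 1 := pow_le_one₀ (norm_nonneg _) hq.le
  calc _ ≤ (‖a‖ ^ 3) ^ n * 1 * 2 := by gcongr
    _ = _ := by ring

lemma f_eq {q a : ℂ} (hq : ‖q‖ < 1) (ha : ‖a‖ < 1) :
    f q a = ∑' n : ℕ, a ^ (3 * n) * q ^ (n * (3 * n + 2)) * (1 - a * q ^ (2 * n + 1)) := by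
  obtain ⟨M, hM⟩ := f_bound hq
  have h3 : ‖a‖ ^ 3 < 1 := pow_lt_one₀ (norm_nonneg _) ha (by norm_num)
  have h0 : Tendsto (fun N : ℕ => a ^ (3 * N) * q ^ (N * (3 * N + 2)) * f q (a * q ^ (2 * N)))
      atTop (𝓝 0) := by
    have hz : Tendsto (fun N : ℕ => (‖a‖ ^ 3) ^ N * M) atTop (𝓝 0) := by
      simpa using (tendsto_pow_atTop_nhds_zero_of_lt_one (by positivity) h3).mul_const M
    refine squeeze_zero_norm (fun N => ?_) hz
    rw [norm_mul, norm_mul, norm_pow, norm_pow, pow_mul]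
    have h1 := hM _ (nxm hq ha (2 * N))
    have h2 : ‖q‖ ^ (N * (3 * N + 2)) ≤ 1 := pow_le_one₀ (norm_nonneg _) hq.le
    calc _ ≤ (‖a‖ ^ 3) ^ N * 1 * M := by gcongr
      _ = _ := by ring
  have h := (rhs_summable hq ha).hasSum.tendsto_sum_nat.add h0
  rw [add_zero] at h
  exact tendsto_nhds_unique
    (tendsto_const_nhds.congr fun N => f_iter hq ha N) h

end RA

/-- First residual identity \eqref{RA}. -/
theorem stmt_13 (q a : ℂ) (hq : ‖q‖ < 1) (ha : ‖a‖ < 1) :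
    ∑' n : ℕ, qPoch (a ^ 2 * q ^ (n + 1)) q n * q ^ n / (qPoch q q n * qPoch (a * q) q n)
      = (∑' n : ℕ, a ^ (3 * n) * q ^ (n * (3 * n + 2)) * (1 - a * q ^ (2 * n + 1)))
          / (qPochInf q q * qPochInf (a * q) q) := by
  have h := RA.f_eq hq ha
  have hB := RA.qPochInf_ne hq (RA.nx hq ha)
  have hQ := RA.qPochInf_ne hq hq
  rw [← h, RA.f, mul_div_cancel_left₀ _ (mul_ne_zero hQ hB)]
  rfl
end
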